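/- arXiv:2212.07565 — 2 statements merged into one kernel-verified Lean document; each statement's English description precedes it below -/
import Mathlib

section
/- Let f : ℝⁿ → ℝⁿ be continuously differentiable, Φ : ℝⁿ → ℝ continuous, and let B ⊆ ℝⁿ be compact and forward invariant (every trajectory of ẋ = f(x) starting in B remains in B for all t ≥ 0). Then sup_{x₀ ∈ B} Φ̄(x₀) = inf_{V ∈ C¹(ℝⁿ)} sup_{x ∈ B} [Φ(x) + f(x) · ∇V(x)]. -/
open Filter MeasureTheory
open scoped RealInnerProductSpace


set_option linter.unusedSectionVars false

section flow
variable {E : Type*} [NormedAddCommGroup E] [NormedSpace ℝ E]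

theorem traj_dist_nonneg {g : E → E} {K : NNReal} (hg : LipschitzWith K g) {u v : ℝ → E}
    (hu : ∀ t, HasDerivAt u (g (u t)) t) (hv : ∀ t, HasDerivAt v (g (v t)) t) {t : ℝ}
    (ht : 0 ≤ t) :
    dist (u t) (v t) ≤ dist (u 0) (v 0) * Real.exp (K * t) := by
  have := dist_le_of_trajectories_ODE (v := fun _ => g) (K := K) (a := 0) (b := t) (f := u) (g := v)
    (fun _ => hg)
    (fun s _ => (hu s).continuousAt.continuousWithinAt) (fun s _ => (hu s).hasDerivWithinAt)
    (fun s _ => (hv s).continuousAt.continuousWithinAt) (fun s _ => (hv s).hasDerivWithinAt)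
    le_rfl t ⟨ht, le_rfl⟩
  simpa using this

theorem traj_dist {g : E → E} {K : NNReal} (hg : LipschitzWith K g) {u v : ℝ → E}
    (hu : ∀ t, HasDerivAt u (g (u t)) t) (hv : ∀ t, HasDerivAt v (g (v t)) t) (t : ℝ) :
    dist (u t) (v t) ≤ dist (u 0) (v 0) * Real.exp (K * |t|) := by
  rcases le_total 0 t with ht | ht
  · rw [abs_of_nonneg ht]; exact traj_dist_nonneg hg hu hv ht
  · have hg' : LipschitzWith K (fun x => - g x) := hg.neg
    have rev : ∀ w : ℝ → E, (∀ t, HasDerivAt w (g (w t)) t) →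
        ∀ t, HasDerivAt (fun s => w (-s)) (- g (w (-t))) t := by
      intro w hw t
      have := (hw (-t)).scomp t (hasDerivAt_neg t)
      simpa [Function.comp_def] using this
    have := traj_dist_nonneg hg' (rev u hu) (rev v hv) (t := -t) (by linarith)
    rw [abs_of_nonpos ht]
    simpa using this

theorem traj_unique {g : E → E} {K : NNReal} (hg : LipschitzWith K g) {u v : ℝ → E}
    (hu : ∀ t, HasDerivAt u (g (u t)) t) (hv : ∀ t, HasDerivAt v (g (v t)) t) (h0 : u 0 = v 0)
    (t : ℝ) : u t = v t := by
  have := traj_dist hg hu hv t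
  rw [h0, dist_self, zero_mul] at this
  exact dist_le_zero.1 this

theorem exists_traj [CompleteSpace E] {g : E → E} {K M : NNReal} (hg : LipschitzWith K g)
    (hM : ∀ x, ‖g x‖ ≤ M) (x : E) :
    ∃ u : ℝ → E, u 0 = x ∧ ∀ t, HasDerivAt u (g (u t)) t := by
  have key : ∀ N : ℕ, ∃ α : ℝ → E, α 0 = x ∧
      ∀ t ∈ Set.Ioo (-(N:ℝ)) N, HasDerivAt α (g (α t)) t := by
    intro N
    have h0 : (0:ℝ) ∈ Set.Icc (-(N:ℝ)) N := by constructor <;> simp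
    have hpl : IsPicardLindelof (fun _ => g) (⟨0, h0⟩ : Set.Icc (-(N:ℝ)) N) x (M * N) 0 M K :=
      { lipschitzOnWith := fun t _ => hg.lipschitzOnWith
        continuousOn := fun x _ => continuousOn_const
        norm_le := fun t _ x _ => hM x
        mul_max_le := by simp }
    obtain ⟨α, h1, h2⟩ := hpl.exists_eq_forall_mem_Icc_hasDerivWithinAt₀
    exact ⟨α, h1, fun t ht => (h2 t (Set.Ioo_subset_Icc_self ht)).hasDerivAt
      (Icc_mem_nhds ht.1 ht.2)⟩
  choose α h1 h2 using key
  have agree : ∀ N M : ℕ, N ≤ M → ∀ t ∈ Set.Ioo (-(N:ℝ)) N, α N t = α M t := by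
    intro N M hNM t ht
    have hNM' : (N:ℝ) ≤ M := by exact_mod_cast hNM
    have h0 : (0:ℝ) ∈ Set.Ioo (-(N:ℝ)) N := by
      have := ht.1.trans ht.2
      constructor <;> linarith
    exact ODE_solution_unique_of_mem_Ioo (v := fun _ => g) (s := fun _ => Set.univ) (K := K)
      (fun _ _ => hg.lipschitzOnWith) h0
      (fun s hs => ⟨h2 N s hs, trivial⟩)
      (fun s hs => ⟨h2 M s ⟨by linarith [hs.1], by linarith [hs.2]⟩, trivial⟩)
      (by rw [h1, h1]) ht
  let c : ℝ → ℕ := fun t => ⌈|t|⌉₊ + 1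
  have hc : ∀ t, |t| < c t := fun t => by
    have := Nat.le_ceil |t|
    simp only [c]; push_cast; linarith
  have hφ : ∀ N : ℕ, ∀ t ∈ Set.Ioo (-(N:ℝ)) N, α (c t) t = α N t := by
    intro N t ht
    have ht' : t ∈ Set.Ioo (-(c t:ℝ)) (c t) := abs_lt.1 (hc t)
    rcases le_total N (c t) with h | h
    · exact (agree _ _ h t ht).symm
    · exact agree _ _ h t ht'
  refine ⟨fun t => α (c t) t, h1 _, fun t => ?_⟩
  have ht' : t ∈ Set.Ioo (-(c t:ℝ)) (c t) := abs_lt.1 (hc t)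
  refine (h2 (c t) t ht').congr_of_eventuallyEq ?_
  filter_upwards [Ioo_mem_nhds ht'.1 ht'.2] with s hs
  exact hφ _ s hs

/-- `φ` is a global flow of the vector field `g`. -/
structure IsFlow (g : E → E) (φ : E → ℝ → E) : Prop where
  zero : ∀ x, φ x 0 = x
  deriv : ∀ x t, HasDerivAt (φ x) (g (φ x t)) t

theorem exists_flow [CompleteSpace E] {g : E → E} {K M : NNReal} (hg : LipschitzWith K g)
    (hM : ∀ x, ‖g x‖ ≤ M) : ∃ φ : E → ℝ → E, IsFlow g φ := by
  choose φ h1 h2 using exists_traj hg hM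
  exact ⟨φ, h1, h2⟩

variable {g : E → E} {φ : E → ℝ → E} {K : NNReal}

theorem IsFlow.cont (h : IsFlow g φ) (x : E) : Continuous (φ x) :=
  continuous_iff_continuousAt.2 fun t => (h.deriv x t).continuousAt

theorem IsFlow.dist_le (h : IsFlow g φ) (hg : LipschitzWith K g) (x y : E) (t : ℝ) :
    dist (φ x t) (φ y t) ≤ dist x y * Real.exp (K * |t|) := by
  have := traj_dist hg (h.deriv x) (h.deriv y) t
  rwa [h.zero, h.zero] at this

theorem IsFlow.add (h : IsFlow g φ) (hg : LipschitzWith K g) (x : E) (s t : ℝ) :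
    φ (φ x s) t = φ x (s + t) := by
  refine traj_unique hg (h.deriv _) (v := fun t => φ x (s + t)) (fun t => ?_) (by simp [h.zero]) t
  exact (h.deriv x (s + t)).comp_const_add s t

theorem IsFlow.cont_uncurry (h : IsFlow g φ) (hg : LipschitzWith K g) :
    Continuous (Function.uncurry φ) := by
  rw [continuous_iff_continuousAt]
  rintro ⟨x, t⟩
  rw [ContinuousAt, tendsto_iff_dist_tendsto_zero]
  have h1 : Tendsto (fun p : E × ℝ => dist p.1 x * Real.exp (K * |p.2|) + dist (φ x p.2) (φ x t))
      (nhds (x, t)) (nhds 0) := by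
    have hc := h.cont x
    have : Continuous (fun p : E × ℝ => dist p.1 x * Real.exp (K * |p.2|)
      + dist (φ x p.2) (φ x t)) := by fun_prop
    simpa using this.tendsto (x, t)
  refine squeeze_zero (fun _ => dist_nonneg) (fun p => ?_) h1
  exact (dist_triangle _ (φ x p.2) _).trans (add_le_add_left (h.dist_le hg _ _ _) _)

theorem IsFlow.dist_self_le (h : IsFlow g φ) {M : ℝ} (hM : ∀ x, ‖g x‖ ≤ M) (x : E) {t : ℝ}
    (ht : 0 ≤ t) : dist (φ x t) x ≤ M * t := by
  have := norm_image_sub_le_of_norm_deriv_le_segment' (f := φ x) (a := 0) (b := t) (C := M)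
    (fun s _ => (h.deriv x s).hasDerivWithinAt) (fun s _ => hM _) t ⟨ht, le_rfl⟩
  rw [h.zero, sub_zero] at this
  rwa [dist_eq_norm]

end flow

section supconv
variable {E : Type*} [NormedAddCommGroup E] [NormedSpace ℝ E]

/-- Sup-convolution of `Φ` restricted to `B`. -/
noncomputable def supConv (Φ : E → ℝ) (B : Set E) (k : ℕ) (x : E) : ℝ :=
  ⨆ y : B, (Φ y - k * dist x y)

variable {Φ : E → ℝ} {B : Set E} {M : ℝ}

theorem supConv_bdd (hM : ∀ x ∈ B, |Φ x| ≤ M) (k : ℕ) (x : E) :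
    BddAbove (Set.range fun y : B => Φ y - k * dist x y) := by
  refine ⟨M, ?_⟩
  rintro _ ⟨y, rfl⟩
  have h1 := (abs_le.1 (hM y y.2)).2
  have : 0 ≤ (k:ℝ) * dist x y := by positivity
  simp only; linarith

theorem le_supConv (hM : ∀ x ∈ B, |Φ x| ≤ M) (k : ℕ) (x y : E) (hy : y ∈ B) :
    Φ y - k * dist x y ≤ supConv Φ B k x :=
  le_ciSup (supConv_bdd hM k x) ⟨y, hy⟩

theorem le_supConv_self (hM : ∀ x ∈ B, |Φ x| ≤ M) (k : ℕ) (x : E) (hx : x ∈ B) :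
    Φ x ≤ supConv Φ B k x := by
  simpa using le_supConv hM k x x hx

theorem supConv_le_infDist (hB : B.Nonempty) (hM : ∀ x ∈ B, |Φ x| ≤ M) (k : ℕ) (x : E) :
    supConv Φ B k x ≤ M - k * Metric.infDist x B := by
  have := hB.to_subtype
  refine ciSup_le fun y => ?_
  have h1 := (abs_le.1 (hM y y.2)).2
  have h2 : (k:ℝ) * Metric.infDist x B ≤ k * dist x y :=
    mul_le_mul_of_nonneg_left (Metric.infDist_le_dist_of_mem y.2) (by positivity)
  linarith

theorem supConv_lip (hB : B.Nonempty) (hM : ∀ x ∈ B, |Φ x| ≤ M) (k : ℕ) :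
    LipschitzWith k (supConv Φ B k) := by
  have := hB.to_subtype
  refine LipschitzWith.of_le_add_mul _ fun x z => ?_
  refine ciSup_le fun y => ?_
  have h1 := le_supConv hM k z y y.2
  have h2 : (k:ℝ) * dist z y ≤ k * (dist x z + dist x y) :=
    mul_le_mul_of_nonneg_left (dist_triangle_left z y x) (by positivity)
  simp only [NNReal.coe_natCast]
  linarith

theorem supConv_anti (hB : B.Nonempty) (hM : ∀ x ∈ B, |Φ x| ≤ M) {j k : ℕ} (hjk : j ≤ k) (x : E) :
    supConv Φ B k x ≤ supConv Φ B j x := by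
  have := hB.to_subtype
  refine ciSup_le fun y => ?_
  refine le_trans ?_ (le_supConv hM j x y y.2)
  have : (j:ℝ) ≤ k := by exact_mod_cast hjk
  gcongr

theorem supConv_tendsto (hΦ : Continuous Φ) (hM : ∀ x ∈ B, |Φ x| ≤ M) (x : E) (hx : x ∈ B) :
    Tendsto (fun k => supConv Φ B k x) atTop (nhds (Φ x)) := by
  have hne : Nonempty B := ⟨⟨x, hx⟩⟩
  rw [Metric.tendsto_atTop]
  intro ε hε
  obtain ⟨δ, hδ, h⟩ := Metric.continuous_iff.1 hΦ x (ε/2) (by positivity)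
  obtain ⟨N, hN⟩ := exists_nat_gt ((M - Φ x) / δ)
  refine ⟨N, fun k hk => ?_⟩
  have h1 := le_supConv_self hM k x hx
  have hk' : (N:ℝ) ≤ k := by exact_mod_cast hk
  have hkk : M - Φ x ≤ k * δ := by
    rw [div_lt_iff₀ hδ] at hN
    nlinarith
  have h2 : supConv Φ B k x ≤ Φ x + ε/2 := by
    refine ciSup_le fun y => ?_
    rcases lt_or_ge (dist x (y:E)) δ with hy | hy
    · have := h y (by rwa [dist_comm])
      rw [Real.dist_eq] at this
      have := (abs_lt.1 this).2
      have : 0 ≤ (k:ℝ) * dist x y := by positivity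
      linarith
    · have h1 := (abs_le.1 (hM y y.2)).2
      have : (k:ℝ) * δ ≤ k * dist x y := mul_le_mul_of_nonneg_left hy (by positivity)
      linarith
  rw [Real.dist_eq, abs_of_nonneg (by linarith)]
  linarith

theorem exists_supConv {g : E → E} {φ : E → ℝ → E} {K : NNReal} (h : IsFlow g φ)
    (hg : LipschitzWith K g) (hΦ : Continuous Φ) (hBc : IsCompact B) (hB : B.Nonempty)
    (hM : ∀ x ∈ B, |Φ x| ≤ M) {T c : ℝ} (hT : 0 < T)
    (hc : ∀ x ∈ B, (∀ t ∈ Set.Icc 0 T, φ x t ∈ B) → ∫ t in (0:ℝ)..T, Φ (φ x t) < c) :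
    ∃ k : ℕ, ∀ x ∈ B, ∫ t in (0:ℝ)..T, supConv Φ B k (φ x t) < c := by
  by_contra! hcon
  have hjc := h.cont_uncurry hg
  have hΨc : ∀ k, Continuous (supConv Φ B k) := fun k => (supConv_lip hB hM k).continuous
  have hint : ∀ k x, IntervalIntegrable (fun t => supConv Φ B k (φ x t)) volume 0 T := fun k x =>
    ((hΨc k).comp (h.cont x)).intervalIntegrable _ _
  have hcont : ∀ k, Continuous fun x => ∫ t in (0:ℝ)..T, supConv Φ B k (φ x t) := fun k =>
    intervalIntegral.continuous_parametric_intervalIntegral_of_continuous'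
      (f := fun x t => supConv Φ B k (φ x t)) ((hΨc k).comp hjc) 0 T
  let C : ℕ → Set E := fun k => B ∩ {x | c ≤ ∫ t in (0:ℝ)..T, supConv Φ B k (φ x t)}
  have hCcl : ∀ k, IsClosed {x | c ≤ ∫ t in (0:ℝ)..T, supConv Φ B k (φ x t)} := fun k =>
    isClosed_le continuous_const (hcont k)
  obtain ⟨x, hx⟩ : (⋂ k, C k).Nonempty := by
    apply IsCompact.nonempty_iInter_of_sequence_nonempty_isCompact_isClosed C
    · rintro k x ⟨hx, hx2⟩
      have hx2' : c ≤ ∫ t in (0:ℝ)..T, supConv Φ B (k+1) (φ x t) := hx2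
      refine ⟨hx, le_trans (b := ∫ t in (0:ℝ)..T, supConv Φ B (k+1) (φ x t)) hx2' ?_⟩
      exact intervalIntegral.integral_mono hT.le (hint _ _) (hint _ _)
        (fun t => supConv_anti hB hM (Nat.le_succ k) _)
    · intro k; obtain ⟨x, hx, hx2⟩ := hcon k; exact ⟨x, hx, hx2⟩
    · exact hBc.inter_right (hCcl 0)
    · intro k; exact hBc.isClosed.inter (hCcl k)
  rw [Set.mem_iInter] at hx
  have hxB : x ∈ B := (hx 0).1
  have hx2 : ∀ k, c ≤ ∫ t in (0:ℝ)..T, supConv Φ B k (φ x t) := fun k => (hx k).2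
  have hdc : Continuous fun t => Metric.infDist (φ x t) B :=
    (Metric.continuous_infDist_pt B).comp (h.cont x)
  -- stays in B
  have hstay : ∀ t ∈ Set.Icc 0 T, φ x t ∈ B := by
    by_contra! hne
    obtain ⟨t0, ht0, hne⟩ := hne
    have hpos : 0 < ∫ t in (0:ℝ)..T, Metric.infDist (φ x t) B := by
      refine intervalIntegral.integral_pos hT hdc.continuousOn
        (fun _ _ => Metric.infDist_nonneg) ⟨t0, ht0, ?_⟩
      exact (hBc.isClosed.notMem_iff_infDist_pos hB).1 hne
    obtain ⟨k, hk⟩ := exists_nat_gt ((M * T - c) / ∫ t in (0:ℝ)..T, Metric.infDist (φ x t) B)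
    rw [div_lt_iff₀ hpos] at hk
    have h1 : ∫ t in (0:ℝ)..T, supConv Φ B k (φ x t) ≤
        ∫ t in (0:ℝ)..T, (M - k * Metric.infDist (φ x t) B) := by
      refine intervalIntegral.integral_mono hT.le (hint _ _) ?_
        (fun t => supConv_le_infDist hB hM k _)
      exact Continuous.intervalIntegrable (by fun_prop) _ _
    rw [intervalIntegral.integral_sub (by simp)
      (Continuous.intervalIntegrable (by fun_prop) _ _),
      intervalIntegral.integral_const_mul] at h1
    simp at h1
    have := hx2 k
    nlinarith
  have hlim : Tendsto (fun k => ∫ t in (0:ℝ)..T, supConv Φ B k (φ x t)) atTop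
      (nhds (∫ t in (0:ℝ)..T, Φ (φ x t))) := by
    refine intervalIntegral.tendsto_integral_filter_of_dominated_convergence (fun _ => M) ?_ ?_ ?_ ?_
    · exact Eventually.of_forall fun k => ((hΨc k).comp (h.cont x)).aestronglyMeasurable
    · refine Eventually.of_forall fun k => Eventually.of_forall fun t ht => ?_
      rw [Set.uIoc_of_le hT.le] at ht
      have hb := hstay t ⟨ht.1.le, ht.2⟩
      rw [Real.norm_eq_abs, abs_le]
      have h1 := le_supConv_self hM k _ hb
      have h2 := supConv_le_infDist hB hM k (φ x t)
      rw [Metric.infDist_zero_of_mem hb, mul_zero] at h2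
      have h3 := (abs_le.1 (hM _ hb)).1
      constructor <;> linarith
    · simp
    · refine Eventually.of_forall fun t ht => ?_
      rw [Set.uIoc_of_le hT.le] at ht
      exact supConv_tendsto hΦ hM _ (hstay t ⟨ht.1.le, ht.2⟩)
  have := ge_of_tendsto' hlim hx2
  linarith [hc x hxB hstay]

end supconv

section aux
variable {E : Type*} [NormedAddCommGroup E] [NormedSpace ℝ E]
  {g : E → E} {φ : E → ℝ → E} {K : NNReal}

/-- The auxiliary function obtained by averaging along the flow. -/
noncomputable def auxV (φ : E → ℝ → E) (Ψ : E → ℝ) (T : ℝ) (x : E) : ℝ :=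
  (1 / T) * ∫ s in (0:ℝ)..T, ∫ t in (0:ℝ)..s, Ψ (φ x t)

/-- The derivative of `auxV` along the flow. -/
noncomputable def auxD (φ : E → ℝ → E) (Ψ : E → ℝ) (T : ℝ) (x : E) : ℝ :=
  (1 / T) * (∫ t in (0:ℝ)..T, Ψ (φ x t)) - Ψ x

theorem aux_hasDerivAt (h : IsFlow g φ) (hg : LipschitzWith K g) {Ψ : E → ℝ} (hΨ : Continuous Ψ)
    {T : ℝ} (hT : 0 < T) (x : E) (r : ℝ) :
    HasDerivAt (fun r => auxV φ Ψ T (φ x r)) (auxD φ Ψ T (φ x r)) r := by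
  have hc : Continuous fun t => Ψ (φ x t) := hΨ.comp (h.cont x)
  have hi : ∀ a b, IntervalIntegrable (fun t => Ψ (φ x t)) volume a b :=
    fun a b => hc.intervalIntegrable _ _
  set P : ℝ → ℝ := fun s => ∫ t in (0:ℝ)..s, Ψ (φ x t) with hP
  have hPd : ∀ s, HasDerivAt P (Ψ (φ x s)) s := fun s =>
    intervalIntegral.integral_hasDerivAt_right (hi _ _) (hc.stronglyMeasurableAtFilter _ _)
      hc.continuousAt
  have hPc : Continuous P := continuous_iff_continuousAt.2 fun s => (hPd s).continuousAt
  have hPi : ∀ a b, IntervalIntegrable P volume a b := fun a b => hPc.intervalIntegrable _ _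
  set Q : ℝ → ℝ := fun s => ∫ t in (0:ℝ)..s, P t with hQ
  have hQd : ∀ s, HasDerivAt Q (P s) s := fun s =>
    intervalIntegral.integral_hasDerivAt_right (hPi _ _) (hPc.stronglyMeasurableAtFilter _ _)
      hPc.continuousAt
  have e1 : ∀ r s, ∫ t in (0:ℝ)..s, Ψ (φ (φ x r) t) = P (r + s) - P r := by
    intro r s
    simp_rw [h.add hg]
    rw [intervalIntegral.integral_comp_add_left (fun t => Ψ (φ x t)) r, add_zero, hP]
    simp only
    rw [intervalIntegral.integral_interval_sub_left (hi _ _) (hi _ _)]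
  have e2 : ∀ r, auxV φ Ψ T (φ x r) = (1 / T) * (Q (r + T) - Q r - T * P r) := by
    intro r
    unfold auxV
    simp_rw [e1]
    have hh : IntervalIntegrable (fun s => P (r + s)) volume 0 T :=
      Continuous.intervalIntegrable (by fun_prop) _ _
    rw [intervalIntegral.integral_sub hh (by simp),
      intervalIntegral.integral_comp_add_left P r, add_zero, hQ]
    simp only
    rw [intervalIntegral.integral_interval_sub_left (hPi _ _) (hPi _ _)]
    simp
  have e3 : auxD φ Ψ T (φ x r) = (1 / T) * (P (r + T) - P r - T * Ψ (φ x r)) := by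
    unfold auxD
    rw [e1]
    field_simp
  rw [e3]
  simp_rw [e2]
  exact ((((hQd (r + T)).comp_add_const r T).sub (hQd r)).sub ((hPd r).const_mul T)).const_mul _

theorem aux_inner_lip (h : IsFlow g φ) (hg : LipschitzWith K g) {Ψ : E → ℝ} {k : NNReal}
    (hΨ : LipschitzWith k Ψ) {T : ℝ} {s : ℝ} (hs : s ∈ Set.Icc 0 T) (x y : E) :
    |(∫ t in (0:ℝ)..s, Ψ (φ x t)) - ∫ t in (0:ℝ)..s, Ψ (φ y t)| ≤
      (k * Real.exp (K * T) * T) * dist x y := by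
  have hi : ∀ x, IntervalIntegrable (fun t => Ψ (φ x t)) volume 0 s :=
    fun x => (hΨ.continuous.comp (h.cont x)).intervalIntegrable _ _
  rw [← intervalIntegral.integral_sub (hi x) (hi y), ← Real.norm_eq_abs]
  have := intervalIntegral.norm_integral_le_of_norm_le_const (a := 0) (b := s)
    (f := fun t => Ψ (φ x t) - Ψ (φ y t)) (C := k * (dist x y * Real.exp (K * T))) ?_
  · refine this.trans ?_
    rw [sub_zero, abs_of_nonneg hs.1]
    calc _ ≤ k * (dist x y * Real.exp (K * T)) * T :=
          mul_le_mul_of_nonneg_left hs.2 (by positivity)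
      _ = _ := by ring
  · intro t ht
    rw [Set.uIoc_of_le hs.1] at ht
    rw [← dist_eq_norm]
    refine (hΨ.dist_le_mul _ _).trans ?_
    gcongr
    refine (h.dist_le hg _ _ _).trans ?_
    rw [abs_of_nonneg ht.1.le]
    gcongr
    exact ht.2.trans hs.2

theorem auxD_lip (h : IsFlow g φ) (hg : LipschitzWith K g) {Ψ : E → ℝ} {k : NNReal}
    (hΨ : LipschitzWith k Ψ) {T : ℝ} (hT : 0 < T) :
    ∃ L : NNReal, LipschitzWith L (auxD φ Ψ T) := by
  refine ⟨Real.toNNReal (k * Real.exp (K * T) + k), LipschitzWith.of_dist_le_mul fun x y => ?_⟩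
  rw [Real.coe_toNNReal _ (by positivity), Real.dist_eq]
  have h1 := aux_inner_lip h hg hΨ (T := T) (s := T) ⟨hT.le, le_rfl⟩ x y
  have h2 := hΨ.dist_le_mul x y
  rw [Real.dist_eq] at h2
  unfold auxD
  have e : ∀ a b c d : ℝ, 1 / T * a - c - (1 / T * b - d) = 1 / T * (a - b) - (c - d) := by
    intros; ring
  rw [e]
  refine (abs_sub _ _).trans ?_
  rw [abs_mul, abs_of_nonneg (by positivity : 0 ≤ 1 / T)]
  have h3 := mul_le_mul_of_nonneg_left h1 (by positivity : 0 ≤ 1 / T)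
  have : 1 / T * (k * Real.exp (K * T) * T * dist x y) = k * Real.exp (K * T) * dist x y := by
    field_simp
  rw [this] at h3
  linarith

theorem auxV_lip (h : IsFlow g φ) (hg : LipschitzWith K g) {Ψ : E → ℝ} {k : NNReal}
    (hΨ : LipschitzWith k Ψ) {T : ℝ} (hT : 0 < T) :
    ∃ L : NNReal, LipschitzWith L (auxV φ Ψ T) := by
  refine ⟨Real.toNNReal (k * Real.exp (K * T) * T), LipschitzWith.of_dist_le_mul fun x y => ?_⟩
  rw [Real.coe_toNNReal _ (by positivity), Real.dist_eq]
  have hi : ∀ x, IntervalIntegrable (fun s => ∫ t in (0:ℝ)..s, Ψ (φ x t)) volume 0 T := fun x =>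
    (intervalIntegral.continuous_primitive
      (fun a b => (hΨ.continuous.comp (h.cont x)).intervalIntegrable _ _) 0).intervalIntegrable _ _
  unfold auxV
  rw [← mul_sub, ← intervalIntegral.integral_sub (hi x) (hi y), abs_mul,
    abs_of_nonneg (by positivity : 0 ≤ 1 / T), ← Real.norm_eq_abs]
  have := intervalIntegral.norm_integral_le_of_norm_le_const (a := 0) (b := T)
    (f := fun s => (∫ t in (0:ℝ)..s, Ψ (φ x t)) - ∫ t in (0:ℝ)..s, Ψ (φ y t))
    (C := (k * Real.exp (K * T) * T) * dist x y) (fun s hs => by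
      rw [Set.uIoc_of_le hT.le] at hs
      exact aux_inner_lip h hg hΨ ⟨hs.1.le, hs.2⟩ x y)
  have h3 := mul_le_mul_of_nonneg_left this (by positivity : 0 ≤ 1 / T)
  refine h3.trans (le_of_eq ?_)
  rw [sub_zero, abs_of_pos hT]
  field_simp

theorem aux_step (h : IsFlow g φ) (hg : LipschitzWith K g) {M : NNReal} (hM : ∀ x, ‖g x‖ ≤ M)
    {V D : E → ℝ} {L L' : NNReal} (hV : LipschitzWith L V) (hD : LipschitzWith L' D)
    (hd : ∀ x r, HasDerivAt (fun r => V (φ x r)) (D (φ x r)) r) {δ r : ℝ} (hr : 0 ≤ r)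
    {x z : E} (hz : dist z x ≤ δ) :
    V (z + r • g x) - V z ≤ r * (D x + (L' + L * K) * (δ + M * r)) := by
  have near : ∀ s ∈ Set.Icc 0 r, dist (φ z s) x ≤ δ + M * r := by
    intro s hs
    have h1 := h.dist_self_le hM z hs.1
    have h2 : (M:ℝ) * s ≤ M * r := mul_le_mul_of_nonneg_left hs.2 M.2
    linarith [dist_triangle (φ z s) z x]
  have h1 : V (φ z r) - V z ≤ (D x + L' * (δ + M * r)) * r := by
    have := Convex.image_sub_le_mul_sub_of_deriv_le (convex_Icc 0 r)
      (f := fun r => V (φ z r)) (C := D x + L' * (δ + M * r))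
      (fun s _ => (hd z s).continuousAt.continuousWithinAt)
      (fun s _ => (hd z s).differentiableAt.differentiableWithinAt)
      (fun s hs => by
        rw [(hd z s).deriv]
        have h1 := hD.dist_le_mul (φ z s) x
        rw [Real.dist_eq] at h1
        have h2 := near s (interior_subset hs)
        have h3 := mul_le_mul_of_nonneg_left h2 L'.2
        have h4 := (abs_le.1 h1).2
        simp only [NNReal.val_eq_coe] at h3
        linarith) 0 ⟨le_rfl, hr⟩ r ⟨hr, le_rfl⟩ hr
    simpa [h.zero] using this
  have h2 : ‖(φ z r - r • g x) - z‖ ≤ (K * (δ + M * r)) * r := by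
    have := norm_image_sub_le_of_norm_deriv_le_segment' (f := fun s => φ z s - s • g x)
      (f' := fun s => g (φ z s) - g x)
      (a := 0) (b := r) (C := K * (δ + M * r))
      (fun s _ => by
        have := ((h.deriv z s).fun_sub ((hasDerivAt_id s).smul_const (g x))).hasDerivWithinAt
          (s := Set.Icc 0 r)
        simpa using this)
      (fun s hs => by
        rw [← dist_eq_norm]
        refine (hg.dist_le_mul _ _).trans ?_
        have := near s (Set.Ico_subset_Icc_self hs)
        gcongr) r ⟨hr, le_rfl⟩
    simpa [h.zero] using this
  have h3 : V (z + r • g x) - V (φ z r) ≤ L * ((K * (δ + M * r)) * r) := by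
    have h4 := hV.dist_le_mul (z + r • g x) (φ z r)
    rw [Real.dist_eq] at h4
    refine (le_abs_self _).trans (h4.trans ?_)
    gcongr
    rw [dist_comm, dist_eq_norm]
    have e : φ z r - (z + r • g x) = φ z r - r • g x - z := by abel
    rw [e]
    exact h2
  linarith

end aux

section mollify
variable {n : ℕ}

local notation "𝔼" => EuclideanSpace ℝ (Fin n)

theorem exists_mollified {g : 𝔼 → 𝔼} {φ : 𝔼 → ℝ → 𝔼} {K : NNReal}
    (h : IsFlow g φ) (hg : LipschitzWith K g) {M : NNReal} (hM : ∀ x, ‖g x‖ ≤ M)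
    {V D : 𝔼 → ℝ} {L L' : NNReal} (hV : LipschitzWith L V) (hD : LipschitzWith L' D)
    (hd : ∀ x r, HasDerivAt (fun r => V (φ x r)) (D (φ x r)) r) {ε : ℝ} (hε : 0 < ε) :
    ∃ W : 𝔼 → ℝ, ContDiff ℝ 1 W ∧ ∀ x, fderiv ℝ W x (g x) ≤ D x + ε := by
  set C : ℝ := L' + L * K with hC
  have hC0 : 0 ≤ C := by positivity
  set δ : ℝ := ε / (C + 1) with hδ
  have hδ0 : 0 < δ := by positivity
  have hCδ : C * δ ≤ ε := by
    rw [hδ, mul_div_assoc', div_le_iff₀ (by positivity)]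
    nlinarith
  let b : ContDiffBump (0 : 𝔼) := ⟨δ / 2, δ, by positivity, by linarith⟩
  let ρ : 𝔼 → ℝ := b.normed volume
  have hρc : Continuous ρ := b.continuous_normed
  have hρs : HasCompactSupport ρ := b.hasCompactSupport_normed
  have hρi : ∫ y, ρ y = 1 := b.integral_normed
  let W : 𝔼 → ℝ := fun x => ∫ y, ρ y * V (x - y)
  have hWeq : W = convolution ρ V (ContinuousLinearMap.mul ℝ ℝ) volume := by
    ext x; simp [W, convolution]
  have hW : ContDiff ℝ 1 W := by
    rw [hWeq]
    exact hρs.contDiff_convolution_left (n := 1) _ b.contDiff_normed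
      hV.continuous.locallyIntegrable
  have hint : ∀ x, Integrable (fun y => ρ y * V (x - y)) := by
    intro x
    have hVc := hV.continuous
    refine Continuous.integrable_of_hasCompactSupport (by fun_prop) hρs.mul_right
  refine ⟨W, hW, fun x => ?_⟩
  have hstep : ∀ r : ℝ, 0 ≤ r → W (x + r • g x) - W x ≤ r * (D x + C * (δ + M * r)) := by
    intro r hr
    simp only [W]
    rw [← integral_sub (hint _) (hint _)]
    have : r * (D x + C * (δ + M * r)) = ∫ y, ρ y * (r * (D x + C * (δ + M * r))) := by
      rw [integral_mul_const, hρi, one_mul]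
    rw [this]
    refine integral_mono ((hint _).sub (hint _)) ?_ ?_
    · exact (hρc.integrable_of_hasCompactSupport hρs).mul_const _
    · intro y
      simp only
      rw [← mul_sub]
      by_cases hy : y ∈ Function.support ρ
      · rw [show Function.support ρ = Metric.ball 0 δ from b.support_normed_eq] at hy
        refine mul_le_mul_of_nonneg_left ?_ (b.nonneg_normed y)
        have e : x + r • g x - y = (x - y) + r • g x := by abel
        rw [e]
        refine aux_step h hg hM hV hD hd hr ?_
        rw [mem_ball_zero_iff] at hy
        simpa [dist_eq_norm] using hy.le
      · rw [Function.notMem_support] at hy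
        simp [hy]
  have hder : HasDerivAt (fun r : ℝ => W (x + r • g x)) (fderiv ℝ W x (g x)) 0 := by
    have h1 : HasFDerivAt W (fderiv ℝ W x) (x + (0:ℝ) • g x) := by
      simpa using ((hW.differentiable (by simp)) x).hasFDerivAt
    have h2 : HasDerivAt (fun r : ℝ => x + r • g x) (g x) 0 := by
      simpa using ((hasDerivAt_id (0:ℝ)).smul_const (g x)).const_add x
    exact h1.comp_hasDerivAt (0:ℝ) h2
  have hl := hder.tendsto_slope_zero_right
  have hr : Tendsto (fun r : ℝ => D x + C * (δ + M * r)) (nhdsWithin 0 (Set.Ioi 0))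
      (nhds (D x + C * δ)) := by
    have : Continuous (fun r : ℝ => D x + C * (δ + M * r)) := by fun_prop
    have := (this.tendsto 0).mono_left (nhdsWithin_le_nhds (s := Set.Ioi 0))
    simpa using this
  refine (le_of_tendsto_of_tendsto hl hr ?_).trans (by linarith)
  filter_upwards [self_mem_nhdsWithin] with r hr
  have hr : 0 < r := hr
  have := hstep r hr.le
  simp only [zero_add, zero_smul, add_zero, smul_eq_mul]
  rw [inv_mul_le_iff₀ hr]
  exact this

end mollify

section selection
variable {E : Type*} [NormedAddCommGroup E] [NormedSpace ℝ E]
  {g : E → E} {φ : E → ℝ → E} {K : NNReal} {Φ : E → ℝ} {B : Set E} {M : ℝ}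

/-- If for every horizon some orbit segment in `B` has average at least `c`, then some orbit
stays in `B` and has all averages at least `c - ε`. -/
theorem exists_good_orbit (h : IsFlow g φ) (hg : LipschitzWith K g) (hΦ : Continuous Φ)
    (hBc : IsCompact B) (hM : ∀ x ∈ B, |Φ x| ≤ M) {c ε : ℝ} (hε : 0 < ε)
    (hc : ∀ T > 0, ∃ x ∈ B, (∀ t ∈ Set.Icc 0 T, φ x t ∈ B) ∧ c * T ≤ ∫ t in (0:ℝ)..T, Φ (φ x t)) :
    ∃ y, ∀ s, 0 ≤ s → φ y s ∈ B ∧ (c - ε) * s ≤ ∫ t in (0:ℝ)..s, Φ (φ y t) := by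
  have hjc := h.cont_uncurry hg
  have hi : ∀ x a b, IntervalIntegrable (fun t => Φ (φ x t)) volume a b :=
    fun x a b => (hΦ.comp (h.cont x)).intervalIntegrable _ _
  let S : ℕ → Set E := fun N => {y | ∀ s ∈ Set.Icc (0:ℝ) N,
    φ y s ∈ B ∧ (c - ε) * s ≤ ∫ t in (0:ℝ)..s, Φ (φ y t)}
  have hScl : ∀ N, IsClosed (S N) := by
    intro N
    have : S N = ⋂ s ∈ Set.Icc (0:ℝ) N, ({y | φ y s ∈ B} ∩
        {y | (c - ε) * s ≤ ∫ t in (0:ℝ)..s, Φ (φ y t)}) := by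
      ext y; simp [S]
    rw [this]
    refine isClosed_biInter fun s _ => IsClosed.inter ?_ ?_
    · exact hBc.isClosed.preimage (hjc.comp (by fun_prop : Continuous fun y : E => (y, s)))
    · exact isClosed_le continuous_const
        (intervalIntegral.continuous_parametric_intervalIntegral_of_continuous'
          (f := fun y t => Φ (φ y t)) (hΦ.comp hjc) 0 s)
  have hSB : ∀ N, S N ⊆ B := by
    intro N y hy
    have := (hy 0 ⟨le_rfl, by positivity⟩).1
    rwa [h.zero] at this
  have hSne : ∀ N, (S N).Nonempty := by
    intro N
    -- Lipschitz constant of the deviation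
    set R : ℝ := |M| + |c - ε| + 1 with hR
    have hR0 : 0 < R := by positivity
    set T : ℝ := R * (N + 1) / ε with hT
    have hT0 : 0 < T := by positivity
    obtain ⟨x, hx, hxB, hxc⟩ := hc T hT0
    let a : ℝ → ℝ := fun s => (∫ t in (0:ℝ)..s, Φ (φ x t)) - (c - ε) * s
    have hac : Continuous a := by
      have := intervalIntegral.continuous_primitive (hi x) 0
      fun_prop
    obtain ⟨τ, hτ, hmin⟩ := isCompact_Icc.exists_isMinOn
      (Set.nonempty_Icc.2 hT0.le) hac.continuousOn
    have hmin' : ∀ s ∈ Set.Icc 0 T, a τ ≤ a s := fun s hs => hmin hs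
    have ha0 : a τ ≤ 0 := by
      have := hmin' 0 ⟨le_rfl, hT0.le⟩
      simpa [a] using this
    have haT : ε * T ≤ a T := by simp only [a]; linarith
    have hdiff : ∀ s, a s - a τ = (∫ t in τ..s, Φ (φ x t)) - (c - ε) * (s - τ) := by
      intro s
      rw [← intervalIntegral.integral_interval_sub_left (hi x 0 s) (hi x 0 τ)]
      simp only [a]; ring
    have hbound : a T - a τ ≤ R * (T - τ) := by
      rw [hdiff]
      have h1 := intervalIntegral.norm_integral_le_of_norm_le_const (a := τ) (b := T)
        (f := fun t => Φ (φ x t)) (C := |M|) (fun t ht => by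
          rw [Set.uIoc_of_le hτ.2] at ht
          exact (hM _ (hxB t ⟨hτ.1.trans ht.1.le, ht.2⟩)).trans (le_abs_self _))
      have hTτ : 0 ≤ T - τ := by linarith [hτ.2]
      rw [abs_of_nonneg hTτ, Real.norm_eq_abs] at h1
      have h2 := (abs_le.1 h1).2
      have h3 : -(c - ε) * (T - τ) ≤ |c - ε| * (T - τ) :=
        mul_le_mul_of_nonneg_right (neg_le_abs _) hTτ
      rw [hR]; linarith
    have hlen : (N:ℝ) + 1 ≤ T - τ := by
      have h1 : ε * T = R * (N + 1) := by rw [hT]; field_simp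
      have h2 : R * (N + 1) ≤ R * (T - τ) := by linarith
      exact le_of_mul_le_mul_left h2 hR0
    refine ⟨φ x τ, fun s hs => ?_⟩
    have hs' : τ + s ∈ Set.Icc 0 T := ⟨by linarith [hs.1, hτ.1], by linarith [hs.2]⟩
    simp_rw [h.add hg]
    refine ⟨hxB _ hs', ?_⟩
    rw [intervalIntegral.integral_comp_add_left (fun t => Φ (φ x t)) τ, add_zero]
    have h1 := hmin' _ hs'
    have h2 := hdiff (τ + s)
    have : τ + s - τ = s := by ring
    rw [this] at h2
    linarith
  obtain ⟨y, hy⟩ : (⋂ N, S N).Nonempty := by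
    apply IsCompact.nonempty_iInter_of_sequence_nonempty_isCompact_isClosed S
    · intro N y hy s hs
      refine hy s ⟨hs.1, hs.2.trans ?_⟩
      push_cast; linarith
    · exact hSne
    · exact hBc.of_isClosed_subset (hScl 0) (hSB 0)
    · exact hScl
  rw [Set.mem_iInter] at hy
  refine ⟨y, fun s hs => ?_⟩
  obtain ⟨N, hN⟩ := exists_nat_ge s
  exact hy N s ⟨hs, hN⟩

end selection

section main
variable {n : ℕ}

local notation "𝔼" => EuclideanSpace ℝ (Fin n)

theorem exists_cutoff {f : 𝔼 → 𝔼} (hf : ContDiff ℝ 1 f) {B : Set 𝔼} (hB : IsCompact B) :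
    ∃ (g : 𝔼 → 𝔼) (K M : NNReal), LipschitzWith K g ∧ (∀ x, ‖g x‖ ≤ M) ∧ ∀ x ∈ B, g x = f x := by
  obtain ⟨r, hr0, hr⟩ := hB.isBounded.subset_closedBall_lt 0 0
  let b : ContDiffBump (0 : 𝔼) := ⟨r, r + 1, hr0, by linarith⟩
  let g : 𝔼 → 𝔼 := fun x => b x • f x
  have hgs : HasCompactSupport g := b.hasCompactSupport.smul_right
  have hgc : ContDiff ℝ 1 g := b.contDiff.smul hf
  obtain ⟨K, hK⟩ := hgc.lipschitzWith_of_hasCompactSupport hgs (by simp)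
  obtain ⟨M, hM⟩ := hgs.exists_bound_of_continuous hgc.continuous
  refine ⟨g, K, M.toNNReal, hK, fun x => (hM x).trans (Real.le_coe_toNNReal M), fun x hx => ?_⟩
  have : b x = 1 := b.one_of_mem_closedBall (hr hx)
  simp [g, this]

theorem avg_bounds {Φ : 𝔼 → ℝ} {B : Set 𝔼} {M : ℝ} (hM : ∀ x ∈ B, |Φ x| ≤ M) {x : ℝ → 𝔼}
    (hx : ∀ t : ℝ, 0 ≤ t → x t ∈ B) {T : ℝ} (hT : 0 < T) :
    |(1 / T) * ∫ t in (0:ℝ)..T, Φ (x t)| ≤ M := by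
  have h1 := intervalIntegral.norm_integral_le_of_norm_le_const (a := 0) (b := T)
    (f := fun t => Φ (x t)) (C := M) (fun t ht => by
      rw [Set.uIoc_of_le hT.le] at ht
      exact hM _ (hx t ht.1.le))
  rw [sub_zero, abs_of_pos hT, Real.norm_eq_abs] at h1
  rw [abs_mul, abs_of_pos (by positivity : 0 < 1 / T), one_div, inv_mul_le_iff₀ hT]
  linarith

theorem avg_bddAbove {Φ : 𝔼 → ℝ} {B : Set 𝔼} {M : ℝ} (hM : ∀ x ∈ B, |Φ x| ≤ M) {x : ℝ → 𝔼}
    (hx : ∀ t : ℝ, 0 ≤ t → x t ∈ B) :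
    IsBoundedUnder (· ≤ ·) atTop (fun T : ℝ => (1 / T) * ∫ t in (0:ℝ)..T, Φ (x t)) :=
  isBoundedUnder_of_eventually_le (a := M) (by
    filter_upwards [eventually_gt_atTop 0] with T hT
    exact (abs_le.1 (avg_bounds hM hx hT)).2)

theorem avg_bddBelow {Φ : 𝔼 → ℝ} {B : Set 𝔼} {M : ℝ} (hM : ∀ x ∈ B, |Φ x| ≤ M) {x : ℝ → 𝔼}
    (hx : ∀ t : ℝ, 0 ≤ t → x t ∈ B) :
    IsBoundedUnder (· ≥ ·) atTop (fun T : ℝ => (1 / T) * ∫ t in (0:ℝ)..T, Φ (x t)) :=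
  isBoundedUnder_of_eventually_ge (a := -M) (by
    filter_upwards [eventually_gt_atTop 0] with T hT
    exact (abs_le.1 (avg_bounds hM hx hT)).1)

theorem inner_gradient_eq {V : 𝔼 → ℝ} (x v : 𝔼) : ⟪v, gradient V x⟫ = fderiv ℝ V x v := by
  rw [real_inner_comm, gradient, InnerProductSpace.toDual_symm_apply]

theorem weak_duality {f : 𝔼 → 𝔼} {Φ : 𝔼 → ℝ} (hf : Continuous f) (hΦ : Continuous Φ)
    {B : Set 𝔼} (hB : IsCompact B) {M : ℝ} (hM : ∀ x ∈ B, |Φ x| ≤ M) {x : ℝ → 𝔼}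
    (hd : ∀ t : ℝ, 0 ≤ t → HasDerivAt x (f (x t)) t)
    (hx : ∀ t : ℝ, 0 ≤ t → x t ∈ B) {V : 𝔼 → ℝ} (hV : ContDiff ℝ 1 V) :
    limsup (fun T : ℝ => (1 / T) * ∫ t in (0:ℝ)..T, Φ (x t)) atTop ≤
      sSup ((fun x => Φ x + ⟪f x, gradient V x⟫) '' B) := by
  simp_rw [inner_gradient_eq]
  set F : 𝔼 → ℝ := fun x => Φ x + fderiv ℝ V x (f x) with hF
  have hVc : Continuous fun x => fderiv ℝ V x (f x) :=
    (hV.continuous_fderiv (by simp)).clm_apply hf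
  have hFc : Continuous F := hΦ.add hVc
  have hbdd : BddAbove (F '' B) := (hB.image hFc).bddAbove
  set c := sSup (F '' B) with hc
  have hFle : ∀ y ∈ B, F y ≤ c := fun y hy => le_csSup hbdd ⟨y, hy, rfl⟩
  obtain ⟨A, hA⟩ := hB.exists_bound_of_continuousOn hV.continuous.continuousOn
  have key : ∀ T > 0, (1 / T) * ∫ t in (0:ℝ)..T, Φ (x t) ≤ c + 2 * A / T := by
    intro T hT
    have hxc : ContinuousOn x (Set.uIcc 0 T) := fun t ht => by
      rw [Set.uIcc_of_le hT.le] at ht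
      exact (hd t ht.1).continuousAt.continuousWithinAt
    have i1 : IntervalIntegrable (fun t => Φ (x t)) volume 0 T :=
      (hΦ.comp_continuousOn hxc).intervalIntegrable
    have i2 : IntervalIntegrable (fun t => fderiv ℝ V (x t) (f (x t))) volume 0 T :=
      (hVc.comp_continuousOn hxc).intervalIntegrable
    have e : ∫ t in (0:ℝ)..T, fderiv ℝ V (x t) (f (x t)) = V (x T) - V (x 0) := by
      refine intervalIntegral.integral_eq_sub_of_hasDerivAt (f := fun t => V (x t)) ?_ i2
      intro t ht
      rw [Set.uIcc_of_le hT.le] at ht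
      exact ((hV.differentiable (by simp)) (x t)).hasFDerivAt.comp_hasDerivAt t (hd t ht.1)
    have h1 : ∫ t in (0:ℝ)..T, F (x t) ≤ ∫ t in (0:ℝ)..T, c := by
      refine intervalIntegral.integral_mono_on hT.le (i1.add i2) (by simp) ?_
      intro t ht
      exact hFle _ (hx t ht.1)
    have e2 : ∫ t in (0:ℝ)..T, F (x t) = (∫ t in (0:ℝ)..T, Φ (x t)) + (V (x T) - V (x 0)) := by
      rw [← e, ← intervalIntegral.integral_add i1 i2]
    rw [e2] at h1
    simp at h1
    have a1 := (abs_le.1 (hA _ (hx T hT.le))).1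
    have a2 := (abs_le.1 (hA _ (hx 0 le_rfl))).2
    rw [one_div, inv_mul_le_iff₀ hT, mul_add, mul_div_cancel₀ _ hT.ne']
    linarith
  have hlim : Tendsto (fun T : ℝ => c + 2 * A / T) atTop (nhds c) := by
    simpa using (tendsto_const_nhds (x := c)).add (tendsto_const_nhds.div_atTop tendsto_id)
  rw [← hlim.limsup_eq]
  refine limsup_le_limsup ?_ (avg_bddBelow hM hx).isCoboundedUnder_le hlim.isBoundedUnder_le
  filter_upwards [eventually_gt_atTop 0] with T hT using key T hT

theorem strong_duality {f : 𝔼 → 𝔼} {Φ : 𝔼 → ℝ} (hf : ContDiff ℝ 1 f) (hΦ : Continuous Φ)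
    {B : Set 𝔼} (hBc : IsCompact B) (hB : B.Nonempty) {M : ℝ} (hM : ∀ x ∈ B, |Φ x| ≤ M)
    {c c' : ℝ} (hcc : c < c')
    (hc : ∀ x : ℝ → 𝔼, (∀ t : ℝ, 0 ≤ t → HasDerivAt x (f (x t)) t) → x 0 ∈ B →
      (∀ t : ℝ, 0 ≤ t → x t ∈ B) →
      limsup (fun T : ℝ => (1 / T) * ∫ t in (0:ℝ)..T, Φ (x t)) atTop ≤ c) :
    ∃ V : 𝔼 → ℝ, ContDiff ℝ 1 V ∧ sSup ((fun x => Φ x + ⟪f x, gradient V x⟫) '' B) ≤ c' := by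
  obtain ⟨g, K, N, hg, hN, hgf⟩ := exists_cutoff hf hBc
  obtain ⟨φ, h⟩ := exists_flow hg hN
  set ε := (c' - c) / 3 with hε
  have hε0 : 0 < ε := by rw [hε]; linarith
  have hT : ∃ T > 0, ∀ x ∈ B, (∀ t ∈ Set.Icc 0 T, φ x t ∈ B) →
      ∫ t in (0:ℝ)..T, Φ (φ x t) < (c + 2 * ε) * T := by
    by_contra! hcon
    obtain ⟨y, hy⟩ := exists_good_orbit h hg hΦ hBc hM hε0 hcon
    have h1 := hc (φ y) (fun t ht => by
      have := h.deriv y t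
      rwa [hgf _ (hy t ht).1] at this) (hy 0 le_rfl).1 (fun t ht => (hy t ht).1)
    have h2 : c + ε ≤ limsup (fun T : ℝ => (1 / T) * ∫ t in (0:ℝ)..T, Φ (φ y t)) atTop := by
      refine le_limsup_of_frequently_le (Eventually.frequently ?_)
        (avg_bddAbove hM fun t ht => (hy t ht).1)
      filter_upwards [eventually_gt_atTop 0] with T hT
      have := (hy T hT.le).2
      rw [one_div, le_inv_mul_iff₀ hT]
      linarith
    linarith
  obtain ⟨T, hT0, hT⟩ := hT
  obtain ⟨k, hk⟩ := exists_supConv h hg hΦ hBc hB hM hT0 hT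
  have hΨ := supConv_lip hB hM k
  obtain ⟨L, hL⟩ := auxV_lip h hg hΨ hT0
  obtain ⟨L', hL'⟩ := auxD_lip h hg hΨ hT0
  obtain ⟨W, hW, hWd⟩ := exists_mollified h hg hN hL hL'
    (fun x r => aux_hasDerivAt h hg hΨ.continuous hT0 x r) hε0
  refine ⟨W, hW, csSup_le (hB.image _) ?_⟩
  rintro _ ⟨x, hx, rfl⟩
  simp only [inner_gradient_eq]
  have h1 := hWd x
  rw [hgf x hx] at h1
  have h2 := le_supConv_self hM k x hx
  have h3 : (1 / T) * ∫ t in (0:ℝ)..T, supConv Φ B k (φ x t) ≤ c + 2 * ε := by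
    rw [one_div, inv_mul_le_iff₀ hT0]
    linarith [hk x hx]
  unfold auxD at h1
  linarith

end main



/-- Strong duality: if `B` is compact and forward invariant for `ẋ = f(x)`, then the supremum
over initial conditions in `B` of the time average of `Φ` equals the infimum over continuously
differentiable auxiliary functions `V` of `sup_{x ∈ B} [Φ(x) + f(x)·∇V(x)]`. -/
theorem statement2 {n : ℕ}
    (f : EuclideanSpace ℝ (Fin n) → EuclideanSpace ℝ (Fin n))
    (Φ : EuclideanSpace ℝ (Fin n) → ℝ)
    (hf : ContDiff ℝ 1 f) (hΦ : Continuous Φ)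
    (B : Set (EuclideanSpace ℝ (Fin n)))
    (hBcomp : IsCompact B)
    (hBinv : ∀ x : ℝ → EuclideanSpace ℝ (Fin n),
      (∀ t : ℝ, 0 ≤ t → HasDerivAt x (f (x t)) t) → x 0 ∈ B → ∀ t : ℝ, 0 ≤ t → x t ∈ B) :
    sSup {a : ℝ | ∃ x : ℝ → EuclideanSpace ℝ (Fin n),
        (∀ t : ℝ, 0 ≤ t → HasDerivAt x (f (x t)) t) ∧ x 0 ∈ B ∧
        a = limsup (fun T : ℝ => (1 / T) * ∫ t in (0:ℝ)..T, Φ (x t)) atTop} =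
    sInf {c : ℝ | ∃ V : EuclideanSpace ℝ (Fin n) → ℝ, ContDiff ℝ 1 V ∧
        c = sSup ((fun x => Φ x + ⟪f x, gradient V x⟫) '' B)} := by
  rcases B.eq_empty_or_nonempty with rfl | hB
  · have h1 : {c : ℝ | ∃ V : EuclideanSpace ℝ (Fin n) → ℝ, ContDiff ℝ 1 V ∧
        c = sSup ((fun x => Φ x + ⟪f x, gradient V x⟫) '' (∅ : Set (EuclideanSpace ℝ (Fin n))))} =
        {0} := by
      ext c
      simp only [Set.image_empty, Real.sSup_empty, Set.mem_setOf_eq, Set.mem_singleton_iff]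
      exact ⟨fun ⟨_, _, h⟩ => h, fun h => ⟨fun _ => 0, contDiff_const, h⟩⟩
    rw [h1]
    simp
  obtain ⟨M, hM⟩ := hBcomp.exists_bound_of_continuousOn hΦ.continuousOn
  have hM : ∀ x ∈ B, |Φ x| ≤ M := hM
  set S := {a : ℝ | ∃ x : ℝ → EuclideanSpace ℝ (Fin n),
        (∀ t : ℝ, 0 ≤ t → HasDerivAt x (f (x t)) t) ∧ x 0 ∈ B ∧
        a = limsup (fun T : ℝ => (1 / T) * ∫ t in (0:ℝ)..T, Φ (x t)) atTop} with hS
  set R := {c : ℝ | ∃ V : EuclideanSpace ℝ (Fin n) → ℝ, ContDiff ℝ 1 V ∧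
        c = sSup ((fun x => Φ x + ⟪f x, gradient V x⟫) '' B)} with hR
  have weak : ∀ a ∈ S, ∀ c ∈ R, a ≤ c := by
    rintro a ⟨x, hd, h0, rfl⟩ c ⟨V, hV, rfl⟩
    exact weak_duality hf.continuous hΦ hBcomp hM hd (hBinv x hd h0) hV
  have strong : ∀ c c' : ℝ, c < c' → (∀ a ∈ S, a ≤ c) → ∃ r ∈ R, r ≤ c' := by
    intro c c' hcc hc
    obtain ⟨V, hV, hle⟩ := strong_duality hf hΦ hBcomp hB hM hcc
      (fun x hd h0 _ => hc _ ⟨x, hd, h0, rfl⟩)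
    exact ⟨_, ⟨V, hV, rfl⟩, hle⟩
  have hRne : R.Nonempty := ⟨_, fun _ => 0, contDiff_const, rfl⟩
  rcases S.eq_empty_or_nonempty with hSe | hSne
  · rw [hSe, Real.sSup_empty, Real.sInf_of_not_bddBelow]
    rintro ⟨m, hm⟩
    obtain ⟨r, hr, hle⟩ := strong (m - 2) (m - 1) (by linarith) (by simp [hSe])
    have := hm hr
    linarith
  · obtain ⟨r0, hr0⟩ := hRne
    obtain ⟨a0, ha0⟩ := hSne
    have hSb : BddAbove S := ⟨r0, fun a ha => weak a ha r0 hr0⟩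
    have hRb : BddBelow R := ⟨a0, fun r hr => weak a0 ha0 r hr⟩
    apply le_antisymm
    · exact csSup_le ⟨a0, ha0⟩ fun a ha => le_csInf ⟨r0, hr0⟩ fun r hr => weak a ha r hr
    · refine le_of_forall_gt_imp_ge_of_dense fun c' hc' => ?_
      obtain ⟨r, hr, hle⟩ := strong (sSup S) c' hc' (fun a ha => le_csSup hSb ha)
      exact (csInf_le hRb hr).trans hle
end

section
/- Let f : ℝⁿ → ℝⁿ be twice continuously differentiable, and let B ⊆ ℝⁿ be compact and forward invariant (every trajectory of ẋ = f(x) starting in B remains in B for all t ≥ 0). Then the maximal Lyapunov exponent satisfies μ*_B = inf_{V ∈ C¹(ℝⁿ×ℝⁿ)} sup_{x ∈ B, z ∈ S^{n−1}} ( ⟨z, Df(x) z⟩ + f(x) · ∇ₓV(x,z) + [Df(x) z − ⟨z, Df(x) z⟩ z] · ∇_zV(x,z) ). -/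
open Filter MeasureTheory
open scoped RealInnerProductSpace

section AbstractFlow

variable {X : Type*} [NormedAddCommGroup X] [NormedSpace ℝ X]

/-- Local-in-time solutions of a bounded Lipschitz field on `[-N, N]`. -/
lemma ly_local_sol [CompleteSpace X] (F : X → X) (L : NNReal) (hL : LipschitzWith L F) (M : NNReal)
    (hM : ∀ p, ‖F p‖ ≤ M) (p : X) (N : ℝ) (hN : 0 < N) :
    ∃ γ : ℝ → X, γ 0 = p ∧ ∀ t ∈ Set.Ioo (-N) N, HasDerivAt γ (F (γ t)) t := by
  have h0 : (0:ℝ) ∈ Set.Icc (-N) N := ⟨by linarith, hN.le⟩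
  have hpl : IsPicardLindelof (fun _ => F) (⟨0, h0⟩ : Set.Icc (-N) N) p (M * ⟨N, hN.le⟩) 0 M L :=
    { lipschitzOnWith := fun t _ => hL.lipschitzOnWith
      continuousOn := fun x _ => continuousOn_const
      norm_le := fun t _ x _ => hM x
      mul_max_le := by
        simp only [sub_zero, zero_sub, neg_neg, max_self, NNReal.coe_zero]
        exact le_of_eq rfl }
  obtain ⟨γ, h1, h2⟩ := hpl.exists_eq_forall_mem_Icc_hasDerivWithinAt₀
  exact ⟨γ, h1, fun t ht => (h2 t (Set.Ioo_subset_Icc_self ht)).hasDerivAt (Icc_mem_nhds ht.1 ht.2)⟩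

lemma ly_global_sol [CompleteSpace X] (F : X → X) (L : NNReal) (hL : LipschitzWith L F) (M : NNReal)
    (hM : ∀ p, ‖F p‖ ≤ M) (p : X) :
    ∃ γ : ℝ → X, γ 0 = p ∧ ∀ t, HasDerivAt γ (F (γ t)) t := by
  choose g hg0 hg using fun N : {N : ℝ // 0 < N} => ly_local_sol F L hL M hM p N.1 N.2
  have huniq : ∀ N N' : {N : ℝ // 0 < N}, N.1 ≤ N'.1 → ∀ t ∈ Set.Ioo (-N.1) N.1, g N t = g N' t := by
    intro N N' h t ht
    refine ODE_solution_unique_of_mem_Ioo (v := fun _ => F) (s := fun _ => Set.univ) (K := L)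
      (a := -N.1) (b := N.1) (t₀ := 0)
      (fun t _ => hL.lipschitzOnWith) ⟨by linarith [N.2], N.2⟩ (fun t ht => ⟨hg N t ht, trivial⟩)
      (fun t ht => ⟨hg N' t ⟨by linarith [ht.1], by linarith [ht.2]⟩, trivial⟩)
      ((hg0 N).trans (hg0 N').symm) ht
  let r : ℝ → {N : ℝ // 0 < N} := fun t => ⟨|t| + 1, by positivity⟩
  refine ⟨fun t => g (r t) t, hg0 _, fun t => ?_⟩
  let R : {N : ℝ // 0 < N} := ⟨|t| + 2, by positivity⟩
  have key : ∀ s, |s| < |t| + 1 → g (r s) s = g R s := by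
    intro s hs
    refine huniq _ _ ?_ s ?_
    · change |s| + 1 ≤ |t| + 2
      linarith
    · have := abs_lt.1 (lt_add_one |s|)
      exact ⟨this.1, this.2⟩
  have ev : (fun s => g (r s) s) =ᶠ[nhds t] g R := by
    have : ∀ᶠ s in nhds t, |s| < |t| + 1 :=
      (continuous_abs.tendsto t).eventually (gt_mem_nhds (lt_add_one _))
    exact this.mono key
  have h1 : HasDerivAt (g R) (F (g R t)) t := by
    refine hg R t ?_
    have := abs_lt.1 (show |t| < |t| + 2 by linarith)
    exact ⟨this.1, this.2⟩
  have h2 := h1.congr_of_eventuallyEq ev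
  rw [← key t (by linarith)] at h2
  exact h2

variable {F : X → X} {φ : X → ℝ → X}

lemma ly_flow_add {L : NNReal} (hL : LipschitzWith L F) (h0 : ∀ p, φ p 0 = p)
    (hφ : ∀ p t, HasDerivAt (φ p) (F (φ p t)) t) (p : X) (s t : ℝ) :
    φ p (s + t) = φ (φ p s) t := by
  have := ODE_solution_unique_univ (v := fun _ => F) (s := fun _ => Set.univ) (K := L)
    (f := fun t => φ p (s + t)) (g := φ (φ p s)) (t₀ := 0) (fun _ => hL.lipschitzOnWith)
    (fun t => ⟨(hφ p (s + t)).comp_const_add s t, trivial⟩) (fun t => ⟨hφ _ t, trivial⟩)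
    (by simp [h0])
  exact congrFun this t

lemma ly_flow_cont (hφ : ∀ p t, HasDerivAt (φ p) (F (φ p t)) t) (p : X) : Continuous (φ p) :=
  continuous_iff_continuousAt.2 fun t => (hφ p t).continuousAt

lemma ly_flow_dist {L : NNReal} (hL : LipschitzWith L F) (h0 : ∀ p, φ p 0 = p)
    (hφ : ∀ p t, HasDerivAt (φ p) (F (φ p t)) t) (p q : X) (t : ℝ) (ht : 0 ≤ t) :
    dist (φ p t) (φ q t) ≤ dist p q * Real.exp (L * t) := by
  have := dist_le_of_trajectories_ODE (v := fun _ => F) (K := L) (f := φ p) (g := φ q)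
    (a := 0) (b := t) (δ := dist p q) (fun _ => hL) (ly_flow_cont hφ p).continuousOn
    (fun s _ => (hφ p s).hasDerivWithinAt) (ly_flow_cont hφ q).continuousOn
    (fun s _ => (hφ q s).hasDerivWithinAt) (by simp [h0]) t ⟨ht, le_rfl⟩
  simpa using this

lemma ly_flow_move {M : NNReal} (hM : ∀ p, ‖F p‖ ≤ M) (h0 : ∀ p, φ p 0 = p)
    (hφ : ∀ p t, HasDerivAt (φ p) (F (φ p t)) t) (p : X) (t : ℝ) (ht : 0 ≤ t) :
    ‖φ p t - p‖ ≤ M * t := by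
  have := norm_image_sub_le_of_norm_deriv_le_segment' (f := φ p) (a := 0) (b := t) (C := M)
    (fun s _ => (hφ p s).hasDerivWithinAt) (fun s _ => hM _) t ⟨ht, le_rfl⟩
  simpa [h0] using this

/-- First order expansion of the flow near `p`. -/
lemma ly_flow_taylor {L M : NNReal} (hL : LipschitzWith L F) (hM : ∀ p, ‖F p‖ ≤ M)
    (h0 : ∀ p, φ p 0 = p)
    (hφ : ∀ p t, HasDerivAt (φ p) (F (φ p t)) t) (p q : X) (δ : ℝ) (hpq : ‖q - p‖ ≤ δ)
    (t : ℝ) (ht : 0 ≤ t) :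
    ‖φ q t - (q + t • F p)‖ ≤ L * (M * t + δ) * t := by
  have hd : ∀ s, HasDerivAt (fun s => φ q s - s • F p) (F (φ q s) - F p) s := by
    intro s
    have := (hφ q s).sub ((hasDerivAt_id s).smul_const (F p))
    rw [one_smul] at this
    exact this
  have := norm_image_sub_le_of_norm_deriv_le_segment' (f := fun s => φ q s - s • F p)
    (a := 0) (b := t) (C := L * (M * t + δ))
    (fun s _ => (hd s).hasDerivWithinAt) (fun s hs => ?_) t ⟨ht, le_rfl⟩
  · simp only [h0, zero_smul, sub_zero] at this
    convert this using 2
    abel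
  · rw [← dist_eq_norm]
    refine (hL.dist_le_mul _ _).trans ?_
    gcongr
    rw [dist_eq_norm]
    calc ‖φ q s - p‖ = ‖(φ q s - q) + (q - p)‖ := by congr 1; abel
      _ ≤ ‖φ q s - q‖ + ‖q - p‖ := norm_add_le _ _
      _ ≤ M * t + δ := by
        refine add_le_add ((ly_flow_move hM h0 hφ q s hs.1).trans ?_) hpq
        gcongr
        exact hs.2.le

lemma ly_pliss (g : ℝ → ℝ) (hg : Continuous g) (C ε T : ℝ) (hC : ∀ u, g u ≤ C)
    (hT : 0 ≤ T) (hint : ε * T ≤ ∫ u in (0:ℝ)..T, g u) :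
    ∃ s, 0 ≤ s ∧ ε * T ≤ C * (T - s) ∧ ∀ τ, 0 ≤ τ → τ ≤ T - s → 0 ≤ ∫ u in s..(s + τ), g u := by
  have hi : ∀ a b, IntervalIntegrable g volume a b := fun a b => hg.intervalIntegrable a b
  have hc : Continuous fun s => ∫ u in (0:ℝ)..s, g u :=
    intervalIntegral.continuous_primitive hi 0
  obtain ⟨s, hs, hmin⟩ := isCompact_Icc.exists_isMinOn (Set.nonempty_Icc.2 hT) hc.continuousOn
  refine ⟨s, hs.1, ?_, ?_⟩
  · have h1 : ∫ u in (0:ℝ)..s, g u ≤ 0 := by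
      have := hmin (show (0:ℝ) ∈ Set.Icc 0 T from ⟨le_rfl, hT⟩)
      simpa using this
    have h2 := intervalIntegral.integral_add_adjacent_intervals (hi 0 s) (hi s T)
    have h3 : ∫ u in s..T, g u ≤ ∫ u in s..T, C :=
      intervalIntegral.integral_mono_on hs.2 (hi _ _) (by simp) (fun u _ => hC u)
    rw [intervalIntegral.integral_const, smul_eq_mul] at h3
    linarith
  · intro τ h0 h1
    have h2 := intervalIntegral.integral_add_adjacent_intervals (hi 0 s) (hi s (s + τ))
    have h3 : ∫ u in (0:ℝ)..s, g u ≤ ∫ u in (0:ℝ)..(s + τ), g u :=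
      hmin (show s + τ ∈ Set.Icc 0 T from ⟨by linarith [hs.1], by linarith⟩)
    linarith

lemma ly_int_shift {L : NNReal} (hL : LipschitzWith L F) (h0 : ∀ p, φ p 0 = p)
    (hφ : ∀ p t, HasDerivAt (φ p) (F (φ p t)) t) (g : X → ℝ) (p : X) (s t : ℝ) :
    ∫ u in (0:ℝ)..t, g (φ (φ p s) u) = ∫ u in s..(s + t), g (φ p u) := by
  have : ∀ u, g (φ (φ p s) u) = (fun v => g (φ p v)) (s + u) := fun u => by
    simp only [ly_flow_add hL h0 hφ]
  simp_rw [this]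
  rw [intervalIntegral.integral_comp_add_left (fun v => g (φ p v))]
  simp

lemma ly_int_lip {L : NNReal} (hL : LipschitzWith L F) (h0 : ∀ p, φ p 0 = p)
    (hφ : ∀ p t, HasDerivAt (φ p) (F (φ p t)) t) (g : X → ℝ) {A : NNReal} (hg : LipschitzWith A g)
    (p q : X) (T t : ℝ) (ht : 0 ≤ t) (hT : t ≤ T) :
    |(∫ u in (0:ℝ)..t, g (φ p u)) - ∫ u in (0:ℝ)..t, g (φ q u)|
      ≤ A * Real.exp (L * T) * T * dist p q := by
  have hi : ∀ p, IntervalIntegrable (fun u => g (φ p u)) volume 0 t :=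
    fun p => (hg.continuous.comp (ly_flow_cont hφ p)).intervalIntegrable _ _
  rw [← intervalIntegral.integral_sub (hi p) (hi q), ← Real.norm_eq_abs]
  have := intervalIntegral.norm_integral_le_of_norm_le_const (a := 0) (b := t)
    (f := fun u => g (φ p u) - g (φ q u)) (C := A * (dist p q * Real.exp (L * T))) ?_
  · refine this.trans ?_
    rw [sub_zero, abs_of_nonneg ht]
    calc A * (dist p q * Real.exp (L * T)) * t ≤ A * (dist p q * Real.exp (L * T)) * T := by gcongr
      _ = _ := by ring
  · intro u hu
    rw [Set.uIoc_of_le ht] at hu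
    rw [← dist_eq_norm]
    refine (hg.dist_le_mul _ _).trans ?_
    gcongr
    refine (ly_flow_dist hL h0 hφ p q u hu.1.le).trans ?_
    gcongr
    linarith [hu.2]

lemma ly_int_cont {L : NNReal} (hL : LipschitzWith L F) (h0 : ∀ p, φ p 0 = p)
    (hφ : ∀ p t, HasDerivAt (φ p) (F (φ p t)) t) (g : X → ℝ) {A : NNReal} (hg : LipschitzWith A g)
    (t : ℝ) (ht : 0 ≤ t) : Continuous fun p => ∫ u in (0:ℝ)..t, g (φ p u) := by
  refine (LipschitzWith.of_dist_le_mul (K := ⟨A * Real.exp (L * t) * t, by positivity⟩)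
    fun p q => ?_).continuous
  exact ly_int_lip hL h0 hφ g hg p q t t ht le_rfl

lemma ly_claimA [ProperSpace X] {L M : NNReal} (hL : LipschitzWith L F) (hM : ∀ p, ‖F p‖ ≤ M)
    (h0 : ∀ p, φ p 0 = p) (hφ : ∀ p t, HasDerivAt (φ p) (F (φ p t)) t)
    (K : Set X) (hK : IsCompact K) (hKn : K.Nonempty)
    (Φ : X → ℝ) {A : NNReal} (hΦ : LipschitzWith A Φ) (C : ℝ) (hC : 0 ≤ C) (hΦC : ∀ p, Φ p ≤ C)
    (ε : ℝ) (hε : 0 < ε)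
    (hno : ∀ p ∈ K, (∀ t, 0 ≤ t → φ p t ∈ K) →
      ∃ t, 0 ≤ t ∧ ∫ u in (0:ℝ)..t, Φ (φ p u) < -ε * t) :
    ∃ k : ℕ, ∀ q, ∀ t : ℝ, k ≤ t →
      ∫ u in (0:ℝ)..t, (Φ (φ q u) - k * Metric.infDist (φ q u) K) ≤ 0 := by
  by_contra! hcon
  choose q t hkt hpos using hcon
  have hcφ := fun p => ly_flow_cont hφ p
  have hcΦ : ∀ p, Continuous fun u => Φ (φ p u) := fun p => hΦ.continuous.comp (hcφ p)
  have hcd : ∀ p, Continuous fun u => Metric.infDist (φ p u) K :=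
    fun p => (Metric.continuous_infDist_pt K).comp (hcφ p)
  have hdl : LipschitzWith 1 (fun p => Metric.infDist p K) := Metric.lipschitz_infDist_pt K
  have hii : ∀ (k : ℝ) p a b, IntervalIntegrable
      (fun u => Φ (φ p u) - k * Metric.infDist (φ p u) K) volume a b := fun k p a b =>
    Continuous.intervalIntegrable ((hcΦ p).sub ((hcd p).const_mul k)) a b
  -- good points
  have step1 : ∀ k : ℕ, ∃ r, ∀ τ, 0 ≤ τ → τ ≤ ε * k / (C + ε) →
      k * (∫ u in (0:ℝ)..τ, Metric.infDist (φ r u) K) ≤ (∫ u in (0:ℝ)..τ, Φ (φ r u)) + ε * τ := by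
    intro k
    have htk : 0 ≤ t k := (Nat.cast_nonneg k).trans (hkt k)
    have hcg : Continuous fun u => Φ (φ (q k) u) - k * Metric.infDist (φ (q k) u) K + ε :=
      ((hcΦ _).sub (continuous_const.mul (hcd _))).add continuous_const
    obtain ⟨s, hs0, hs1, hs2⟩ := ly_pliss
      (fun u => Φ (φ (q k) u) - k * Metric.infDist (φ (q k) u) K + ε) hcg (C + ε) ε (t k)
      (fun u => by
        have : 0 ≤ k * Metric.infDist (φ (q k) u) K :=
          mul_nonneg (Nat.cast_nonneg k) Metric.infDist_nonneg
        linarith [hΦC (φ (q k) u)]) htk (by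
        rw [intervalIntegral.integral_add (hii _ _ _ _) (by simp)]
        have := hpos k
        simp only [intervalIntegral.integral_const, smul_eq_mul, sub_zero]
        linarith)
    refine ⟨φ (q k) s, fun τ hτ0 hτ1 => ?_⟩
    have hτ2 : τ ≤ t k - s := by
      refine hτ1.trans ?_
      rw [div_le_iff₀ (by linarith)]
      nlinarith [hkt k]
    have h3 := hs2 τ hτ0 hτ2
    rw [← ly_int_shift hL h0 hφ (fun x => Φ x - k * Metric.infDist x K + ε)] at h3
    rw [intervalIntegral.integral_add (hii _ _ _ _) (by simp),
      intervalIntegral.integral_sub ((hcΦ _).intervalIntegrable _ _)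
        (((hcd _).const_mul _).intervalIntegrable _ _),
      intervalIntegral.integral_const_mul] at h3
    simp only [intervalIntegral.integral_const, smul_eq_mul, sub_zero] at h3
    linarith
  choose r hr using step1
  have hlim : Tendsto (fun k : ℕ => ε * k / (C + ε)) atTop atTop := by
    have : (fun k : ℕ => ε * k / (C + ε)) = fun k : ℕ => (ε / (C + ε)) * (k:ℝ) := by
      ext k; ring
    rw [this]
    exact tendsto_natCast_atTop_atTop.const_mul_atTop (by positivity)
  have hupper : ∀ p τ, 0 ≤ τ → ∫ u in (0:ℝ)..τ, Φ (φ p u) ≤ C * τ := by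
    intro p τ hτ
    have := intervalIntegral.integral_mono_on (μ := volume) hτ ((hcΦ p).intervalIntegrable _ _)
      (g := fun _ => C) (by simp) (fun u _ => hΦC (φ p u))
    simp only [intervalIntegral.integral_const, smul_eq_mul, sub_zero] at this
    linarith
  -- boundedness
  have hev : ∀ᶠ k : ℕ in atTop, Metric.infDist (r k) K ≤ (C + ε) + M := by
    filter_upwards [hlim.eventually_ge_atTop 1, eventually_ge_atTop 1] with k hk hk1
    have h1 := hr k 1 zero_le_one hk
    have h2 := hupper (r k) 1 zero_le_one
    have hk1' : (1:ℝ) ≤ k := by exact_mod_cast hk1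
    have h3 : ∫ u in (0:ℝ)..1, (Metric.infDist (r k) K - M) ≤
        ∫ u in (0:ℝ)..1, Metric.infDist (φ (r k) u) K := by
      refine intervalIntegral.integral_mono_on zero_le_one (by simp)
        ((hcd _).intervalIntegrable _ _) (fun u hu => ?_)
      have h4 := hdl.dist_le_mul (r k) (φ (r k) u)
      have h5 := ly_flow_move hM h0 hφ (r k) u hu.1
      rw [← dist_eq_norm, dist_comm] at h5
      have h6 : (M:ℝ) * u ≤ M := by nlinarith [hu.2, M.2]
      have h7 := le_abs_self (Metric.infDist (r k) K - Metric.infDist (φ (r k) u) K)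
      rw [Real.dist_eq] at h4
      simp only [NNReal.coe_one, one_mul] at h4
      linarith
    simp only [intervalIntegral.integral_const, smul_eq_mul, sub_zero, one_mul] at h3
    have h4 : 0 ≤ ∫ u in (0:ℝ)..1, Metric.infDist (φ (r k) u) K :=
      intervalIntegral.integral_nonneg zero_le_one (fun u _ => Metric.infDist_nonneg)
    nlinarith
  obtain ⟨x0, hx0⟩ := hKn
  have hbdd : Bornology.IsBounded {x | Metric.infDist x K ≤ (C + ε) + M} := by
    obtain ⟨R, hR⟩ := (Metric.isBounded_iff_subset_closedBall x0).1 hK.isBounded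
    refine (Metric.isBounded_iff_subset_closedBall x0).2 ⟨(C + ε) + M + R, fun x hx => ?_⟩
    obtain ⟨y, hy, hxy⟩ := hK.exists_infDist_eq_dist ⟨x0, hx0⟩ x
    have h1 : dist y x0 ≤ R := hR hy
    have h2 : Metric.infDist x K ≤ (C + ε) + M := hx
    rw [Metric.mem_closedBall]
    linarith [dist_triangle x y x0]
  obtain ⟨x, -, σ, hσ, hx⟩ := tendsto_subseq_of_frequently_bounded hbdd hev.frequently
  have hσt : Tendsto (fun j => ((σ j : ℕ) : ℝ)) atTop atTop :=
    tendsto_natCast_atTop_atTop.comp hσ.tendsto_atTop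
  have hI : ∀ τ, 0 ≤ τ → ∫ u in (0:ℝ)..τ, Metric.infDist (φ x u) K ≤ 0 := by
    intro τ hτ
    have h1 := (ly_int_cont hL h0 hφ _ hdl τ hτ).continuousAt.tendsto.comp hx
    have h2 : Tendsto (fun j => (C + ε) * τ / ((σ j : ℕ) : ℝ)) atTop (nhds 0) :=
      hσt.const_div_atTop _
    refine le_of_tendsto_of_tendsto h1 h2 ?_
    filter_upwards [(hlim.comp hσ.tendsto_atTop).eventually_ge_atTop τ,
      hσt.eventually_ge_atTop 1] with j hj hj1
    have h3 := hr (σ j) τ hτ hj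
    have h4 := hupper (r (σ j)) τ hτ
    simp only [Function.comp]
    rw [le_div_iff₀ (by linarith)]
    linarith
  have hmem : ∀ τ, 0 ≤ τ → φ x τ ∈ K := by
    have hpos' : ∀ τ, 0 < τ → φ x τ ∈ K := by
      intro τ hτ
      by_contra hne
      have hd : 0 < Metric.infDist (φ x τ) K :=
        (hK.isClosed.notMem_iff_infDist_pos ⟨x0, hx0⟩).1 hne
      have : 0 < ∫ u in (0:ℝ)..τ, Metric.infDist (φ x u) K := by
        refine intervalIntegral.integral_pos hτ (hcd x).continuousOn
          (fun u _ => Metric.infDist_nonneg) ⟨τ, ⟨hτ.le, le_rfl⟩, hd⟩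
      linarith [hI τ hτ.le]
    intro τ hτ
    rcases hτ.eq_or_lt with h | h
    · subst h
      have h1 : Tendsto (φ x) (nhdsWithin 0 (Set.Ioi 0)) (nhds (φ x 0)) :=
        ((hcφ x).tendsto 0).mono_left nhdsWithin_le_nhds
      exact hK.isClosed.mem_of_tendsto h1 (eventually_nhdsWithin_of_forall fun u hu => hpos' u hu)
    · exact hpos' τ h
  obtain ⟨τ, hτ, hlt⟩ := hno x (by simpa [h0] using hmem 0 le_rfl) hmem
  have h1 := (ly_int_cont hL h0 hφ _ hΦ τ hτ).continuousAt.tendsto.comp hx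
  have h2 : -ε * τ ≤ ∫ u in (0:ℝ)..τ, Φ (φ x u) := by
    refine ge_of_tendsto h1 ?_
    filter_upwards [(hlim.comp hσ.tendsto_atTop).eventually_ge_atTop τ] with j hj
    have h3 := hr (σ j) τ hτ hj
    have h4 : 0 ≤ ∫ u in (0:ℝ)..τ, Metric.infDist (φ (r (σ j)) u) K :=
      intervalIntegral.integral_nonneg hτ (fun u _ => Metric.infDist_nonneg)
    have h5 : (0:ℝ) ≤ ((σ j : ℕ) : ℝ) * ∫ u in (0:ℝ)..τ, Metric.infDist (φ (r (σ j)) u) K := by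
      positivity
    simp only [Function.comp]
    linarith
  linarith

lemma ly_value {L : NNReal} (hL : LipschitzWith L F)
    (h0 : ∀ p, φ p 0 = p) (hφ : ∀ p t, HasDerivAt (φ p) (F (φ p t)) t)
    (Ψ : X → ℝ) {A : NNReal} (hΨ : LipschitzWith A Ψ) (T : ℝ) (hT : 0 ≤ T)
    (hneg : ∀ q t, T ≤ t → ∫ u in (0:ℝ)..t, Ψ (φ q u) ≤ 0) :
    ∃ (V : X → ℝ) (D : NNReal), LipschitzWith D V ∧
      ∀ p τ, 0 ≤ τ → V (φ p τ) + ∫ u in (0:ℝ)..τ, Ψ (φ p u) ≤ V p := by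
  have hi : ∀ p a b, IntervalIntegrable (fun u => Ψ (φ p u)) volume a b :=
    fun p a b => (hΨ.continuous.comp (ly_flow_cont hφ p)).intervalIntegrable a b
  have hex : ∀ p, ∃ t ∈ Set.Icc 0 T, ∀ t' ∈ Set.Icc 0 T,
      ∫ u in (0:ℝ)..t', Ψ (φ p u) ≤ ∫ u in (0:ℝ)..t, Ψ (φ p u) := by
    intro p
    obtain ⟨t, ht, hmax⟩ := isCompact_Icc.exists_isMaxOn (Set.nonempty_Icc.2 hT)
      (intervalIntegral.continuous_primitive (hi p) 0).continuousOn
    exact ⟨t, ht, fun t' ht' => hmax ht'⟩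
  choose m hm hmax using hex
  refine ⟨fun p => ∫ u in (0:ℝ)..(m p), Ψ (φ p u), ⟨A * Real.exp (L * T) * T, by positivity⟩,
    LipschitzWith.of_le_add_mul _ fun p q => ?_, fun p τ hτ => ?_⟩
  · have h1 := ly_int_lip hL h0 hφ Ψ hΨ p q T (m p) (hm p).1 (hm p).2
    have h2 := hmax q (m p) (hm p)
    have h3 := le_abs_self ((∫ u in (0:ℝ)..(m p), Ψ (φ p u)) - ∫ u in (0:ℝ)..(m p), Ψ (φ q u))
    change _ ≤ _ + (A * Real.exp (L * T) * T) * dist p q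
    linarith
  · simp only
    rw [ly_int_shift hL h0 hφ Ψ, add_comm,
      intervalIntegral.integral_add_adjacent_intervals (hi _ _ _) (hi _ _ _)]
    set t := m (φ p τ)
    have ht : t ∈ Set.Icc 0 T := hm _
    rcases le_total (τ + t) T with h | h
    · exact hmax p _ ⟨by linarith [ht.1], h⟩
    · refine (hneg p _ h).trans ?_
      have := hmax p 0 ⟨le_rfl, hT⟩
      simpa using this

lemma ly_mollify [FiniteDimensional ℝ X] {L M : NNReal} (hL : LipschitzWith L F)
    (hM : ∀ p, ‖F p‖ ≤ M) (h0 : ∀ p, φ p 0 = p) (hφ : ∀ p t, HasDerivAt (φ p) (F (φ p t)) t)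
    (Ψ : X → ℝ) {A : NNReal} (hΨ : LipschitzWith A Ψ)
    (V : X → ℝ) {D : NNReal} (hV : LipschitzWith D V)
    (hdis : ∀ p τ, 0 ≤ τ → V (φ p τ) + ∫ u in (0:ℝ)..τ, Ψ (φ p u) ≤ V p)
    (ε : ℝ) (hε : 0 < ε) :
    ∃ W : X → ℝ, ContDiff ℝ 1 W ∧ ∀ p, fderiv ℝ W p (F p) ≤ -Ψ p + ε := by
  let _ : MeasurableSpace X := borel X
  have : BorelSpace X := ⟨rfl⟩
  let μ : Measure X := Measure.addHaar
  let Q : ℝ := D * L + A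
  have hQ : 0 ≤ Q := by positivity
  let δ : ℝ := ε / (Q + 1)
  have hδ : 0 < δ := by positivity
  have hQδ : Q * δ ≤ ε := by
    have : (Q + 1) * δ = ε := by simp only [δ]; field_simp
    nlinarith
  let b : ContDiffBump (0 : X) := ⟨δ / 2, δ, by positivity, by linarith⟩
  let ρ : X → ℝ := b.normed μ
  have hρ0 : ∀ y, 0 ≤ ρ y := fun y => b.nonneg_normed y
  have hρs : ∀ y, δ ≤ ‖y‖ → ρ y = 0 := by
    intro y hy
    have : y ∉ Function.support ρ := by
      rw [b.support_normed_eq]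
      simpa using hy
    simpa using this
  have hρc : Continuous ρ := b.continuous_normed
  have hρcs : HasCompactSupport ρ := b.hasCompactSupport_normed
  have hρi : Integrable ρ μ := hρc.integrable_of_hasCompactSupport hρcs
  have hρ1 : ∫ y, ρ y ∂μ = 1 := b.integral_normed
  let W : X → ℝ := convolution ρ V (ContinuousLinearMap.lsmul ℝ ℝ) μ
  have hW : ContDiff ℝ 1 W :=
    hρcs.contDiff_convolution_left (n := 1) _ b.contDiff_normed
      hV.continuous.locallyIntegrable
  have hWv : ∀ p, W p = ∫ y, ρ y * V (p - y) ∂μ := fun p => rfl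
  have hWi : ∀ p, Integrable (fun y => ρ y * V (p - y)) μ := fun p =>
    (hρc.mul (hV.continuous.comp (continuous_const.sub continuous_id))).integrable_of_hasCompactSupport
      hρcs.mul_right
  refine ⟨W, hW, fun p => ?_⟩
  have hpt : ∀ τ, 0 ≤ τ → ∀ q, ‖q - p‖ ≤ δ →
      V (q + τ • F p) - V q ≤ τ * (-Ψ p + Q * (M * τ + δ)) := by
    intro τ hτ q hq
    have h1 := hV.dist_le_mul (q + τ • F p) (φ q τ)
    have h2 := ly_flow_taylor hL hM h0 hφ p q δ hq τ hτ
    rw [← dist_eq_norm, dist_comm] at h2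
    have h3 := le_abs_self (V (q + τ • F p) - V (φ q τ))
    rw [Real.dist_eq] at h1
    have h4 := hdis q τ hτ
    have h5 : ∫ u in (0:ℝ)..τ, (Ψ p - A * (M * τ + δ)) ≤ ∫ u in (0:ℝ)..τ, Ψ (φ q u) := by
      refine intervalIntegral.integral_mono_on hτ (by simp)
        ((hΨ.continuous.comp (ly_flow_cont hφ q)).intervalIntegrable _ _) (fun u hu => ?_)
      have h6 := hΨ.dist_le_mul p (φ q u)
      have h7 := le_abs_self (Ψ p - Ψ (φ q u))
      rw [Real.dist_eq] at h6
      have h8 : dist p (φ q u) ≤ M * τ + δ := by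
        have h9 := ly_flow_move hM h0 hφ q u hu.1
        have h10 : (M:ℝ) * u ≤ M * τ := by
          have := hu.2
          gcongr
        rw [← dist_eq_norm] at h9 hq
        have := dist_triangle (φ q u) q p
        rw [dist_comm]
        linarith
      have h11 : (A:ℝ) * dist p (φ q u) ≤ A * (M * τ + δ) := by gcongr
      linarith
    simp only [intervalIntegral.integral_const, smul_eq_mul, sub_zero] at h5
    have h12 : (D:ℝ) * dist (q + τ • F p) (φ q τ) ≤ D * (L * (M * τ + δ) * τ) := by gcongr
    have h13 : τ * (-Ψ p + Q * (M * τ + δ)) =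
      D * (L * (M * τ + δ) * τ) - τ * (Ψ p - A * (M * τ + δ)) := by simp only [Q]; ring
    linarith
  have hdiff : ∀ τ, 0 ≤ τ → W (p + τ • F p) - W p ≤ τ * (-Ψ p + Q * (M * τ + δ)) := by
    intro τ hτ
    rw [hWv, hWv, ← integral_sub (hWi _) (hWi _)]
    have : τ * (-Ψ p + Q * (M * τ + δ)) = ∫ y, ρ y * (τ * (-Ψ p + Q * (M * τ + δ))) ∂μ := by
      rw [integral_mul_const, hρ1, one_mul]
    rw [this]
    refine integral_mono ((hWi _).sub (hWi _)) (hρi.mul_const _) (fun y => ?_)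
    simp only
    rcases le_or_gt δ ‖y‖ with hy | hy
    · simp [hρs y hy]
    · rw [← mul_sub]
      refine mul_le_mul_of_nonneg_left ?_ (hρ0 y)
      have h1 := hpt τ hτ (p - y) (by simpa using hy.le)
      have h2 : p + τ • F p - y = p - y + τ • F p := by abel
      rw [h2]
      exact h1
  have hder : HasDerivAt (fun τ : ℝ => W (p + τ • F p)) (fderiv ℝ W p (F p)) 0 := by
    have h1 : HasFDerivAt W (fderiv ℝ W p) (p + (0:ℝ) • F p) := by
      simpa using (hW.differentiable (by simp) p).hasFDerivAt
    have h2 : HasDerivAt (fun τ : ℝ => p + τ • F p) (F p) 0 := by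
      simpa using ((hasDerivAt_id (0:ℝ)).smul_const (F p)).const_add p
    exact h1.comp_hasDerivAt 0 h2
  have hlim := hder.tendsto_slope_zero_right
  have hlim2 : Tendsto (fun τ : ℝ => -Ψ p + Q * (M * τ + δ)) (nhdsWithin 0 (Set.Ioi 0))
      (nhds (-Ψ p + Q * (M * 0 + δ))) := by
    have : Continuous (fun τ : ℝ => -Ψ p + Q * (M * τ + δ)) := by fun_prop
    exact (this.tendsto 0).mono_left nhdsWithin_le_nhds
  have := le_of_tendsto_of_tendsto hlim hlim2 (eventually_nhdsWithin_of_forall fun τ hτ => by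
    have hτ' : 0 < τ := hτ
    have h1 := hdiff τ hτ'.le
    simp only [zero_add, zero_smul, add_zero, smul_eq_mul]
    rw [inv_mul_le_iff₀ hτ']
    exact h1)
  simp only [mul_zero, zero_add] at this
  linarith

/-- Abstract sharpness theorem for a bounded Lipschitz vector field. -/
lemma ly_abstract [FiniteDimensional ℝ X] {L M : NNReal} (hL : LipschitzWith L F)
    (hM : ∀ p, ‖F p‖ ≤ M)
    (K : Set X) (hK : IsCompact K) (hKn : K.Nonempty)
    (Φ : X → ℝ) {A : NNReal} (hΦ : LipschitzWith A Φ) (C : ℝ) (hΦC : ∀ p, Φ p ≤ C)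
    (c ε : ℝ) (hε : 0 < ε)
    (hno : ∀ γ : ℝ → X, (∀ t, HasDerivAt γ (F (γ t)) t) → (∀ t, 0 ≤ t → γ t ∈ K) →
      ∃ t, 0 ≤ t ∧ ∫ u in (0:ℝ)..t, Φ (γ u) < c * t) :
    ∃ W : X → ℝ, ContDiff ℝ 1 W ∧ ∀ p ∈ K, Φ p + fderiv ℝ W p (F p) ≤ c + 2 * ε := by
  have : ProperSpace X := FiniteDimensional.proper_real X
  choose φ h0 hφ using ly_global_sol F L hL M hM
  have hΦ' : LipschitzWith A (fun p => Φ p - (c + ε)) := by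
    refine LipschitzWith.of_dist_le_mul fun p q => ?_
    simpa using hΦ.dist_le_mul p q
  obtain ⟨k, hk⟩ := ly_claimA hL hM h0 hφ K hK hKn (fun p => Φ p - (c + ε)) hΦ'
    (max (C - (c + ε)) 0) (le_max_right _ _)
    (fun p => (sub_le_sub_right (hΦC p) _).trans (le_max_left _ _)) ε hε (by
      intro p _ hmem
      obtain ⟨t, ht, hlt⟩ := hno (φ p) (hφ p) hmem
      refine ⟨t, ht, ?_⟩
      have hi : IntervalIntegrable (fun u => Φ (φ p u)) volume 0 t :=
        (hΦ.continuous.comp (ly_flow_cont hφ p)).intervalIntegrable _ _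
      rw [intervalIntegral.integral_sub hi (by simp)]
      simp only [intervalIntegral.integral_const, smul_eq_mul, sub_zero]
      linarith)
  have hdl : LipschitzWith 1 (fun p => Metric.infDist p K) := Metric.lipschitz_infDist_pt K
  have hΨ : LipschitzWith (A + k) (fun p => Φ p - (c + ε) - k * Metric.infDist p K) := by
    refine LipschitzWith.of_le_add_mul _ fun p q => ?_
    have h1 := hΦ.dist_le_mul p q
    have h2 := hdl.dist_le_mul q p
    rw [Real.dist_eq] at h1 h2
    have h3 := le_abs_self (Φ p - Φ q)
    have h4 := le_abs_self (Metric.infDist q K - Metric.infDist p K)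
    rw [dist_comm q p] at h2
    simp only [NNReal.coe_one, one_mul] at h2
    have h5 : (k:ℝ) * (Metric.infDist q K - Metric.infDist p K) ≤ k * dist p q := by
      gcongr
      linarith
    push_cast
    linarith
  obtain ⟨V, D, hV, hdis⟩ := ly_value hL h0 hφ _ hΨ k (Nat.cast_nonneg k) hk
  obtain ⟨W, hW, hWle⟩ := ly_mollify hL hM h0 hφ _ hΨ V hV hdis ε hε
  refine ⟨W, hW, fun p hp => ?_⟩
  have := hWle p
  rw [Metric.infDist_zero_of_mem hp] at this
  linarith

end AbstractFlow

section Concrete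

variable {n : ℕ}

/-- The growth rate `⟨z, Df(x) z⟩`. -/
noncomputable def lyRate (f : EuclideanSpace ℝ (Fin n) → EuclideanSpace ℝ (Fin n))
    (p : EuclideanSpace ℝ (Fin n) × EuclideanSpace ℝ (Fin n)) : ℝ :=
  ⟪p.2, fderiv ℝ f p.1 p.2⟫

/-- The vector field on the tangent sphere bundle. -/
noncomputable def lyField (f : EuclideanSpace ℝ (Fin n) → EuclideanSpace ℝ (Fin n))
    (p : EuclideanSpace ℝ (Fin n) × EuclideanSpace ℝ (Fin n)) :
    EuclideanSpace ℝ (Fin n) × EuclideanSpace ℝ (Fin n) :=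
  (f p.1, fderiv ℝ f p.1 p.2 - lyRate f p • p.2)

variable {f : EuclideanSpace ℝ (Fin n) → EuclideanSpace ℝ (Fin n)}

lemma ly_lin_contDiff (hf : ContDiff ℝ 2 f) :
    ContDiff ℝ 1 (fun p : EuclideanSpace ℝ (Fin n) × EuclideanSpace ℝ (Fin n) =>
      fderiv ℝ f p.1 p.2) := by
  have h1 : ContDiff ℝ 1 (fderiv ℝ f) := hf.fderiv_right (by norm_num)
  exact (h1.comp contDiff_fst).clm_apply contDiff_snd

lemma lyRate_contDiff (hf : ContDiff ℝ 2 f) : ContDiff ℝ 1 (lyRate f) :=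
  contDiff_snd.inner ℝ (ly_lin_contDiff hf)

lemma lyField_contDiff (hf : ContDiff ℝ 2 f) : ContDiff ℝ 1 (lyField f) :=
  ((hf.of_le (by norm_num)).comp contDiff_fst).prodMk
    ((ly_lin_contDiff hf).sub ((lyRate_contDiff hf).smul contDiff_snd))

lemma ly_L_eq (V : EuclideanSpace ℝ (Fin n) × EuclideanSpace ℝ (Fin n) → ℝ)
    (hV : ContDiff ℝ 1 V) (x z : EuclideanSpace ℝ (Fin n)) :
    ⟪z, fderiv ℝ f x z⟫
            + ⟪f x, gradient (fun x' => V (x', z)) x⟫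
            + ⟪fderiv ℝ f x z - ⟪z, fderiv ℝ f x z⟫ • z,
                gradient (fun z' => V (x, z')) z⟫
      = lyRate f (x, z) + fderiv ℝ V (x, z) (lyField f (x, z)) := by
  have hd : HasFDerivAt V (fderiv ℝ V (x, z)) (x, z) :=
    (hV.differentiable (by simp) (x, z)).hasFDerivAt
  have h1 : HasFDerivAt (fun x' => V (x', z))
      ((fderiv ℝ V (x, z)).comp (ContinuousLinearMap.inl ℝ _ _)) x :=
    HasFDerivAt.comp x hd (hasFDerivAt_prodMk_left x z)
  have h2 : HasFDerivAt (fun z' => V (x, z'))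
      ((fderiv ℝ V (x, z)).comp (ContinuousLinearMap.inr ℝ _ _)) z :=
    HasFDerivAt.comp z hd (hasFDerivAt_prodMk_right x z)
  unfold gradient
  rw [h1.fderiv, h2.fderiv, real_inner_comm _ (f x), InnerProductSpace.toDual_symm_apply,
    real_inner_comm _ (fderiv ℝ f x z - _), InnerProductSpace.toDual_symm_apply]
  have h3 : lyField f (x, z) = (f x, 0) + (0, fderiv ℝ f x z - lyRate f (x, z) • z) := by
    simp [lyField]
  rw [h3, map_add]
  simp [lyRate, add_assoc]

/-- The easy direction: every auxiliary function gives an upper bound. -/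
lemma ly_upper (hf : ContDiff ℝ 2 f) (B : Set (EuclideanSpace ℝ (Fin n))) (hB : IsCompact B)
    (V : EuclideanSpace ℝ (Fin n) × EuclideanSpace ℝ (Fin n) → ℝ) (hV : ContDiff ℝ 1 V) (c : ℝ)
    (hc : ∀ x ∈ B, ∀ z, ‖z‖ = 1 → lyRate f (x, z) + fderiv ℝ V (x, z) (lyField f (x, z)) ≤ c)
    (x y : ℝ → EuclideanSpace ℝ (Fin n))
    (hx : ∀ t : ℝ, 0 ≤ t → HasDerivAt x (f (x t)) t) (hxB : ∀ t : ℝ, 0 ≤ t → x t ∈ B)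
    (hy : ∀ t : ℝ, 0 ≤ t → HasDerivAt y (fderiv ℝ f (x t) (y t)) t) (hy0 : ‖y 0‖ = 1) :
    limsup (fun T : ℝ => (1 / T) * Real.log ‖y T‖) atTop ≤ c := by
  -- bound on Df
  obtain ⟨M, hM⟩ : ∃ M, ∀ x ∈ B, ‖fderiv ℝ f x‖ ≤ M :=
    hB.exists_bound_of_continuousOn (hf.continuous_fderiv (by simp)).continuousOn
  have hsq : ∀ t, 0 ≤ t → HasDerivAt (fun t => ‖y t‖ ^ 2) (2 * ⟪y t, fderiv ℝ f (x t) (y t)⟫) t :=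
    fun t ht => (hy t ht).norm_sq
  -- lower bound
  have hlow : ∀ t, 0 ≤ t → Real.exp (-(2 * M * t)) ≤ ‖y t‖ ^ 2 := by
    have hd : ∀ t, 0 ≤ t → HasDerivAt (fun t => Real.exp (2 * M * t) * ‖y t‖ ^ 2)
        (Real.exp (2 * M * t) * (2 * M) * ‖y t‖ ^ 2
          + Real.exp (2 * M * t) * (2 * ⟪y t, fderiv ℝ f (x t) (y t)⟫)) t := by
      intro t ht
      have h1 : HasDerivAt (fun t => Real.exp (2 * M * t)) (Real.exp (2 * M * t) * (2 * M)) t := by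
        have := ((hasDerivAt_id t).const_mul (2 * M)).exp
        simpa using this
      exact h1.mul (hsq t ht)
    have hmono : MonotoneOn (fun t => Real.exp (2 * M * t) * ‖y t‖ ^ 2) (Set.Ici 0) := by
      refine monotoneOn_of_deriv_nonneg (convex_Ici 0)
        (fun t ht => (hd t ht).continuousAt.continuousWithinAt)
        (fun t ht => (hd t (interior_subset ht)).differentiableAt.differentiableWithinAt) ?_
      intro t ht
      have ht0 : 0 ≤ t := interior_subset ht
      rw [(hd t ht0).deriv]
      have h1 : |⟪y t, fderiv ℝ f (x t) (y t)⟫| ≤ M * ‖y t‖ ^ 2 := by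
        calc |⟪y t, fderiv ℝ f (x t) (y t)⟫| ≤ ‖y t‖ * ‖fderiv ℝ f (x t) (y t)‖ :=
              abs_real_inner_le_norm _ _
          _ ≤ ‖y t‖ * (M * ‖y t‖) := by
              gcongr
              exact (fderiv ℝ f (x t)).le_of_opNorm_le (hM _ (hxB t ht0)) _
          _ = M * ‖y t‖ ^ 2 := by ring
      have h2 := neg_abs_le ⟪y t, fderiv ℝ f (x t) (y t)⟫
      have h3 : 0 ≤ Real.exp (2 * M * t) *
          (2 * (M * ‖y t‖ ^ 2 + ⟪y t, fderiv ℝ f (x t) (y t)⟫)) := by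
        refine mul_nonneg (Real.exp_pos _).le ?_
        linarith
      linarith
    intro t ht
    have h1 : Real.exp (2 * M * 0) * ‖y 0‖ ^ 2 ≤ Real.exp (2 * M * t) * ‖y t‖ ^ 2 :=
      hmono (Set.mem_Ici.2 le_rfl) (Set.mem_Ici.2 ht) ht
    simp only [mul_zero, Real.exp_zero, hy0, one_pow, mul_one] at h1
    rw [Real.exp_neg, inv_le_iff_one_le_mul₀' (Real.exp_pos _)]
    exact h1
  have hyne : ∀ t, 0 ≤ t → y t ≠ 0 := by
    intro t ht h
    have := hlow t ht
    rw [h] at this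
    simp only [norm_zero, ne_eq, OfNat.ofNat_ne_zero, not_false_eq_true, zero_pow] at this
    linarith [Real.exp_pos (-(2 * M * t))]
  let N : ℝ → ℝ := fun t => (1 / 2) * Real.log (‖y t‖ ^ 2)
  have hN : ∀ t, N t = Real.log ‖y t‖ := by
    intro t
    simp only [N, Real.log_pow]
    push_cast
    ring
  let z : ℝ → EuclideanSpace ℝ (Fin n) := fun t => Real.exp (-N t) • y t
  have hexp : ∀ t, 0 ≤ t → Real.exp (-N t) = ‖y t‖⁻¹ := by
    intro t ht
    rw [hN, Real.exp_neg, Real.exp_log (norm_pos_iff.2 (hyne t ht))]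
  have hz1 : ∀ t, 0 ≤ t → ‖z t‖ = 1 := by
    intro t ht
    simp only [z]
    rw [hexp t ht, norm_smul, norm_inv, norm_norm,
      inv_mul_cancel₀ (norm_ne_zero_iff.2 (hyne t ht))]
  have hNd : ∀ t, 0 ≤ t → HasDerivAt N (lyRate f (x t, z t)) t := by
    intro t ht
    have hne : ‖y t‖ ^ 2 ≠ 0 := pow_ne_zero _ (norm_ne_zero_iff.2 (hyne t ht))
    have h1 := ((hsq t ht).log hne).const_mul (1 / 2 : ℝ)
    refine HasDerivAt.congr_deriv h1 ?_
    simp only [lyRate, z, hexp t ht, map_smul, real_inner_smul_left, real_inner_smul_right]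
    field_simp
  have hzd : ∀ t, 0 ≤ t →
      HasDerivAt z (fderiv ℝ f (x t) (z t) - lyRate f (x t, z t) • z t) t := by
    intro t ht
    have h1 := (hNd t ht).neg.exp.smul (hy t ht)
    refine HasDerivAt.congr_deriv h1 ?_
    simp only [z, map_smul, smul_smul, Pi.neg_apply]
    symm
    rw [sub_eq_add_neg, ← neg_smul]
    congr 2
    ring
  have hVd : ∀ t, 0 ≤ t → HasDerivAt (fun t => N t + V (x t, z t) - c * t)
      (lyRate f (x t, z t) + fderiv ℝ V (x t, z t) (lyField f (x t, z t)) - c) t := by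
    intro t ht
    have h1 : HasFDerivAt V (fderiv ℝ V (x t, z t)) (x t, z t) :=
      (hV.differentiable (by simp) _).hasFDerivAt
    have h2 : HasDerivAt (fun t => (x t, z t)) (lyField f (x t, z t)) t :=
      (hx t ht).prodMk (hzd t ht)
    have h3 : HasDerivAt (fun t => V (x t, z t)) (fderiv ℝ V (x t, z t) (lyField f (x t, z t))) t :=
      h1.comp_hasDerivAt t h2
    have h4 : HasDerivAt (fun t => c * t) c t := by
      simpa using (hasDerivAt_id t).const_mul c
    exact ((hNd t ht).add h3).sub h4
  have hanti : AntitoneOn (fun t => N t + V (x t, z t) - c * t) (Set.Ici 0) := by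
    refine antitoneOn_of_deriv_nonpos (convex_Ici 0)
      (fun t ht => (hVd t ht).continuousAt.continuousWithinAt)
      (fun t ht => (hVd t (interior_subset ht)).differentiableAt.differentiableWithinAt) ?_
    intro t ht
    have ht0 : 0 ≤ t := interior_subset ht
    rw [(hVd t ht0).deriv]
    linarith [hc (x t) (hxB t ht0) (z t) (hz1 t ht0)]
  obtain ⟨R, hR⟩ : ∃ R, ∀ p ∈ B ×ˢ Metric.sphere (0 : EuclideanSpace ℝ (Fin n)) 1, ‖V p‖ ≤ R :=
    (hB.prod (isCompact_sphere _ _)).exists_bound_of_continuousOn hV.continuous.continuousOn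
  have hVR : ∀ t, 0 ≤ t → |V (x t, z t)| ≤ R := fun t ht =>
    hR _ ⟨hxB t ht, by simp [hz1 t ht]⟩
  have hbound : ∀ T, 0 ≤ T → Real.log ‖y T‖ ≤ c * T + 2 * R := by
    intro T hT
    have h1 : N T + V (x T, z T) - c * T ≤ N 0 + V (x 0, z 0) - c * 0 :=
      hanti (Set.mem_Ici.2 le_rfl) (Set.mem_Ici.2 hT) hT
    rw [hN, hN, hy0, Real.log_one] at h1
    linarith [neg_abs_le (V (x T, z T)), le_abs_self (V (x 0, z 0)), hVR T hT, hVR 0 le_rfl]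
  have hcob : IsCoboundedUnder (· ≤ ·) atTop (fun T : ℝ => (1 / T) * Real.log ‖y T‖) := by
    refine isCoboundedUnder_le_of_eventually_le (x := -M) _ ?_
    filter_upwards [eventually_gt_atTop 0] with T hT
    have h1 := Real.log_le_log (Real.exp_pos _) (hlow T hT.le)
    rw [Real.log_exp, Real.log_pow] at h1
    push_cast at h1
    rw [one_div, ← div_eq_inv_mul, le_div_iff₀ hT]
    linarith
  refine le_of_forall_pos_le_add fun ε hε => ?_
  refine limsup_le_of_le hcob ?_
  have hlim : Tendsto (fun T : ℝ => 2 * R / T) atTop (nhds 0) := tendsto_id.const_div_atTop _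
  filter_upwards [eventually_gt_atTop 0, hlim.eventually_le_const hε] with T hT h2
  have h1 := hbound T hT.le
  rw [one_div, ← div_eq_inv_mul, div_le_iff₀ hT]
  rw [div_le_iff₀ hT] at h2
  linarith

/-- The hard direction. -/
lemma ly_lower (hf : ContDiff ℝ 2 f) (B : Set (EuclideanSpace ℝ (Fin n))) (hB : IsCompact B)
    (hBn : B.Nonempty) (e : EuclideanSpace ℝ (Fin n)) (he : ‖e‖ = 1) (c ε : ℝ) (hε : 0 < ε)
    (hA : ∀ x y : ℝ → EuclideanSpace ℝ (Fin n),
      (∀ t : ℝ, 0 ≤ t → HasDerivAt x (f (x t)) t) → x 0 ∈ B →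
      (∀ t : ℝ, 0 ≤ t → HasDerivAt y (fderiv ℝ f (x t) (y t)) t) → ‖y 0‖ = 1 →
      limsup (fun T : ℝ => (1 / T) * Real.log ‖y T‖) atTop < c) :
    ∃ V : EuclideanSpace ℝ (Fin n) × EuclideanSpace ℝ (Fin n) → ℝ, ContDiff ℝ 1 V ∧
      ∀ x ∈ B, ∀ z, ‖z‖ = 1 →
        lyRate f (x, z) + fderiv ℝ V (x, z) (lyField f (x, z)) ≤ c + 2 * ε := by
  let K : Set (EuclideanSpace ℝ (Fin n) × EuclideanSpace ℝ (Fin n)) := B ×ˢ Metric.sphere 0 1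
  have hK : IsCompact K := hB.prod (isCompact_sphere _ _)
  obtain ⟨b0, hb0⟩ := hBn
  have hKn : K.Nonempty := ⟨(b0, e), hb0, by simp [he]⟩
  obtain ⟨R, hRpos, hR⟩ := hK.isBounded.subset_closedBall_lt 0 0
  let χ : ContDiffBump (0 : EuclideanSpace ℝ (Fin n) × EuclideanSpace ℝ (Fin n)) :=
    ⟨R, R + 1, hRpos, by linarith⟩
  have hχ1 : ∀ p ∈ K, χ p = 1 := fun p hp => χ.one_of_mem_closedBall (hR hp)
  have hχc : ContDiff ℝ 1 χ := χ.contDiff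
  have hχs : HasCompactSupport χ := χ.hasCompactSupport
  let F := fun p => χ p • lyField f p
  let Φ := fun p => χ p * lyRate f p
  have hFc : ContDiff ℝ 1 F := hχc.smul (lyField_contDiff hf)
  have hΦc : ContDiff ℝ 1 Φ := hχc.mul (lyRate_contDiff hf)
  have hFs : HasCompactSupport F := hχs.smul_right
  have hΦs : HasCompactSupport Φ := hχs.mul_right
  obtain ⟨L, hL⟩ := hFc.lipschitzWith_of_hasCompactSupport hFs (by simp)
  obtain ⟨A, hA'⟩ := hΦc.lipschitzWith_of_hasCompactSupport hΦs (by simp)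
  obtain ⟨M, hM⟩ := hFs.exists_bound_of_continuous hFc.continuous
  obtain ⟨C, hC⟩ := hΦs.exists_bound_of_continuous hΦc.continuous
  have hΦC : ∀ p, Φ p ≤ C := fun p => (le_abs_self _).trans (hC p)
  have hFK : ∀ p ∈ K, F p = lyField f p := fun p hp => by simp [F, hχ1 p hp]
  have hΦK : ∀ p ∈ K, Φ p = lyRate f p := fun p hp => by simp [Φ, hχ1 p hp]
  obtain ⟨W, hW, hWle⟩ := ly_abstract (M := M.toNNReal) hL
    (fun p => (hM p).trans (Real.le_coe_toNNReal M)) K hK hKn Φ hA' C hΦC c ε hε (by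
    intro γ hγ hmem
    by_contra! hcon
    have hγc : Continuous γ := continuous_iff_continuousAt.2 fun t => (hγ t).continuousAt
    have hc1 : Continuous fun u => Φ (γ u) := hΦc.continuous.comp hγc
    let I : ℝ → ℝ := fun t => ∫ u in (0:ℝ)..t, Φ (γ u)
    have hI : ∀ t, HasDerivAt I (Φ (γ t)) t := fun t =>
      intervalIntegral.integral_hasDerivAt_right (hc1.intervalIntegrable _ _)
        (hc1.stronglyMeasurableAtFilter _ _) hc1.continuousAt
    have hz1 : ∀ t, 0 ≤ t → ‖(γ t).2‖ = 1 := fun t ht => by simpa using (hmem t ht).2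
    have hγ' : ∀ t, 0 ≤ t → HasDerivAt γ (lyField f (γ t)) t := fun t ht => by
      rw [← hFK _ (hmem t ht)]
      exact hγ t
    have hγ1 : ∀ t, 0 ≤ t → HasDerivAt (fun t => (γ t).1) (f (γ t).1) t := fun t ht =>
      (hasFDerivAt_fst (𝕜 := ℝ) (p := γ t)).comp_hasDerivAt t (hγ' t ht)
    have hγ2 : ∀ t, 0 ≤ t → HasDerivAt (fun t => (γ t).2)
        (fderiv ℝ f (γ t).1 (γ t).2 - lyRate f (γ t) • (γ t).2) t := fun t ht =>
      (hasFDerivAt_snd (𝕜 := ℝ) (p := γ t)).comp_hasDerivAt t (hγ' t ht)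
    have hnorm : ∀ t, 0 ≤ t → Real.log ‖Real.exp (I t) • (γ t).2‖ = I t := by
      intro t ht
      rw [norm_smul, hz1 t ht, mul_one, Real.norm_eq_abs, Real.abs_exp, Real.log_exp]
    have h1 := hA (fun t => (γ t).1) (fun t => Real.exp (I t) • (γ t).2) hγ1
      (hmem 0 le_rfl).1 (fun t ht => by
        have h2 := (hI t).exp.smul (hγ2 t ht)
        refine HasDerivAt.congr_deriv h2 ?_
        rw [hΦK _ (hmem t ht), map_smul, smul_sub, smul_smul]
        abel) (by simp [I, hz1 0 le_rfl])
    refine absurd h1 (not_lt.2 ?_)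
    have hub : IsBoundedUnder (· ≤ ·) atTop
        (fun T : ℝ => (1 / T) * Real.log ‖Real.exp (I T) • (γ T).2‖) := by
      refine isBoundedUnder_of_eventually_le (a := C) ?_
      filter_upwards [eventually_gt_atTop 0] with T hT
      rw [hnorm T hT.le, one_div, ← div_eq_inv_mul, div_le_iff₀ hT]
      have := intervalIntegral.integral_mono_on (μ := volume) hT.le
        (hc1.intervalIntegrable 0 T)
        (g := fun _ => C) (by simp) (fun u _ => hΦC (γ u))
      simp only [intervalIntegral.integral_const, smul_eq_mul, sub_zero] at this
      simp only [I]
      linarith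
    refine le_limsup_of_frequently_le (Eventually.frequently ?_) hub
    filter_upwards [eventually_gt_atTop 0] with T hT
    rw [hnorm T hT.le, one_div, ← div_eq_inv_mul, le_div_iff₀ hT]
    exact hcon T hT.le)
  refine ⟨W, hW, fun x hx z hz => ?_⟩
  have hp : (x, z) ∈ K := ⟨hx, by simp [hz]⟩
  have := hWle _ hp
  rwa [hFK _ hp, hΦK _ hp] at this

end Concrete

/-- Sharpness of the auxiliary-function bound on the maximal Lyapunov exponent: if `f` is
twice continuously differentiable and `B` is compact and forward invariant for `ẋ = f(x)`,
then the maximal Lyapunov exponent `μ*_B` equals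
`inf_V sup_{x ∈ B, ‖z‖=1} (⟨z, Df(x) z⟩ + f(x)·∇ₓV(x,z) + [Df(x)z − ⟨z,Df(x)z⟩z]·∇_zV(x,z))`,
the infimum being over continuously differentiable `V : ℝⁿ×ℝⁿ → ℝ`. -/
theorem statement8 {n : ℕ}
    (f : EuclideanSpace ℝ (Fin n) → EuclideanSpace ℝ (Fin n))
    (hf : ContDiff ℝ 2 f)
    (B : Set (EuclideanSpace ℝ (Fin n)))
    (hBcomp : IsCompact B)
    (hBinv : ∀ x : ℝ → EuclideanSpace ℝ (Fin n),
      (∀ t : ℝ, 0 ≤ t → HasDerivAt x (f (x t)) t) → x 0 ∈ B → ∀ t : ℝ, 0 ≤ t → x t ∈ B) :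
    sSup {a : ℝ | ∃ x y : ℝ → EuclideanSpace ℝ (Fin n),
        (∀ t : ℝ, 0 ≤ t → HasDerivAt x (f (x t)) t) ∧ x 0 ∈ B ∧
        (∀ t : ℝ, 0 ≤ t → HasDerivAt y (fderiv ℝ f (x t) (y t)) t) ∧ ‖y 0‖ = 1 ∧
        a = limsup (fun T : ℝ => (1 / T) * Real.log ‖y T‖) atTop} =
    sInf {c : ℝ | ∃ V : EuclideanSpace ℝ (Fin n) × EuclideanSpace ℝ (Fin n) → ℝ,
        ContDiff ℝ 1 V ∧
        c = sSup {L : ℝ | ∃ x ∈ B, ∃ z : EuclideanSpace ℝ (Fin n), ‖z‖ = 1 ∧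
          L = ⟪z, fderiv ℝ f x z⟫
            + ⟪f x, gradient (fun x' => V (x', z)) x⟫
            + ⟪fderiv ℝ f x z - ⟪z, fderiv ℝ f x z⟫ • z,
                gradient (fun z' => V (x, z')) z⟫}} := by
  let S : (EuclideanSpace ℝ (Fin n) × EuclideanSpace ℝ (Fin n) → ℝ) → Set ℝ := fun V =>
    {L : ℝ | ∃ x ∈ B, ∃ z : EuclideanSpace ℝ (Fin n), ‖z‖ = 1 ∧
      L = ⟪z, fderiv ℝ f x z⟫
            + ⟪f x, gradient (fun x' => V (x', z)) x⟫
            + ⟪fderiv ℝ f x z - ⟪z, fderiv ℝ f x z⟫ • z,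
                gradient (fun z' => V (x, z')) z⟫}
  set Aset : Set ℝ := {a : ℝ | ∃ x y : ℝ → EuclideanSpace ℝ (Fin n),
        (∀ t : ℝ, 0 ≤ t → HasDerivAt x (f (x t)) t) ∧ x 0 ∈ B ∧
        (∀ t : ℝ, 0 ≤ t → HasDerivAt y (fderiv ℝ f (x t) (y t)) t) ∧ ‖y 0‖ = 1 ∧
        a = limsup (fun T : ℝ => (1 / T) * Real.log ‖y T‖) atTop} with hAset
  change sSup Aset = sInf {c : ℝ | ∃ V, ContDiff ℝ 1 V ∧ c = sSup (S V)}
  set Cset : Set ℝ := {c : ℝ | ∃ V, ContDiff ℝ 1 V ∧ c = sSup (S V)} with hCset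
  have hCne : Cset.Nonempty := ⟨_, fun _ => 0, contDiff_const, rfl⟩
  by_cases hne : ∃ b ∈ B, ∃ e : EuclideanSpace ℝ (Fin n), ‖e‖ = 1
  swap
  · have hA0 : Aset = ∅ := by
      rw [Set.eq_empty_iff_forall_notMem]
      rintro a ⟨x, y, -, hx, -, hy, -⟩
      exact hne ⟨_, hx, _, hy⟩
    have hS0 : ∀ V, S V = ∅ := by
      intro V
      rw [Set.eq_empty_iff_forall_notMem]
      rintro a ⟨x, hx, z, hz, -⟩
      exact hne ⟨_, hx, _, hz⟩
    have hC0 : Cset = {0} := by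
      refine Set.eq_singleton_iff_nonempty_unique_mem.2 ⟨hCne, ?_⟩
      rintro c ⟨V, -, rfl⟩
      rw [hS0, Real.sSup_empty]
    rw [hA0, hC0, Real.sSup_empty, csInf_singleton]
  obtain ⟨b, hb, e, he⟩ := hne
  have hSne : ∀ V, (S V).Nonempty := fun V => ⟨_, b, hb, e, he, rfl⟩
  have hSbdd : ∀ V, ContDiff ℝ 1 V → BddAbove (S V) := by
    intro V hV
    have hcont : Continuous fun p => lyRate f p + fderiv ℝ V p (lyField f p) :=
      (lyRate_contDiff hf).continuous.add
        ((hV.continuous_fderiv (by simp)).clm_apply (lyField_contDiff hf).continuous)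
    obtain ⟨R, hR⟩ := (hBcomp.prod
      (isCompact_sphere (0 : EuclideanSpace ℝ (Fin n)) 1)).exists_bound_of_continuousOn
        hcont.continuousOn
    refine ⟨R, ?_⟩
    rintro L ⟨x, hx, z, hz, rfl⟩
    rw [ly_L_eq V hV]
    exact (le_abs_self _).trans (hR (x, z) ⟨hx, by simp [hz]⟩)
  have fact1 : ∀ a ∈ Aset, ∀ c ∈ Cset, a ≤ c := by
    rintro a ⟨x, y, hx, hx0, hy, hy0, rfl⟩ c ⟨V, hV, rfl⟩
    refine ly_upper hf B hBcomp V hV _ ?_ x y hx (hBinv x hx hx0) hy hy0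
    intro x' hx' z hz
    refine le_csSup (hSbdd V hV) ⟨x', hx', z, hz, ?_⟩
    rw [ly_L_eq V hV]
  have fact2 : ∀ c ε : ℝ, 0 < ε → (∀ a ∈ Aset, a < c) → ∃ d ∈ Cset, d ≤ c + 2 * ε := by
    intro c ε hε hlt
    obtain ⟨V, hV, hle⟩ := ly_lower hf B hBcomp ⟨b, hb⟩ e he c ε hε
      (fun x y h1 h2 h3 h4 => hlt _ ⟨x, y, h1, h2, h3, h4, rfl⟩)
    refine ⟨_, ⟨V, hV, rfl⟩, csSup_le (hSne V) ?_⟩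
    rintro L ⟨x, hx, z, hz, rfl⟩
    rw [ly_L_eq V hV]
    exact hle x hx z hz
  rcases Aset.eq_empty_or_nonempty with hA0 | hA0
  · have hnb : ¬ BddBelow Cset := by
      rintro ⟨m, hm⟩
      obtain ⟨d, hd, hdle⟩ := fact2 (m - 3) 1 one_pos (by rw [hA0]; simp)
      have := hm hd
      linarith
    rw [hA0, Real.sSup_empty, Real.sInf_of_not_bddBelow hnb]
  · obtain ⟨c0, hc0⟩ := hCne
    have hAb : BddAbove Aset := ⟨c0, fun a ha => fact1 a ha c0 hc0⟩
    obtain ⟨a0, ha0⟩ := hA0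
    have hCb : BddBelow Cset := ⟨a0, fun c hc => fact1 a0 ha0 c hc⟩
    refine le_antisymm ?_ ?_
    · exact csSup_le ⟨a0, ha0⟩ fun a ha => le_csInf ⟨c0, hc0⟩ fun c hc => fact1 a ha c hc
    · refine le_of_forall_pos_le_add fun ε hε => ?_
      obtain ⟨d, hd, hdle⟩ := fact2 (sSup Aset + ε / 3) (ε / 3) (by positivity)
        (fun a ha => (le_csSup hAb ha).trans_lt (by linarith))
      have := csInf_le hCb hd
      linarith
end
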